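/- There exists an absolute constant L₀ > 0 with the following property: let {D_j} be a collection of closed unit disks in ℝ² = ℂ whose pairwise distances are at least 100, and let u be a real-valued harmonic function on ℂ ∖ ⋃_j D_j which does not change sign on each annulus 5D_j ∖ D_j. If |u(z)| ≤ e^{−L|z|} for all z ∈ ℂ ∖ ⋃_j D_j and some L ≥ L₀, then u is identically zero. -/

import Mathlib

noncomputable section

open MeasureTheory Metric Filter Set
open scoped Topology ENNReal RealInnerProductSpace

/-- The Euclidean plane. -/
abbrev E2 : Type := EuclideanSpace ℝ (Fin 2)

/-- The Laplacian of a function on `ℝⁿ`, computed via iterated Fréchet derivatives in the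
coordinate directions. -/
def lap {n : ℕ} (f : EuclideanSpace ℝ (Fin n) → ℝ) (x : EuclideanSpace ℝ (Fin n)) : ℝ :=
  ∑ i : Fin n, fderiv ℝ (fun y => fderiv ℝ f y (EuclideanSpace.single i 1)) x
    (EuclideanSpace.single i 1)

/-- A test function on a set `Ω`: smooth, compactly supported, with support inside `Ω`. -/
def IsTestFun {n : ℕ} (Ω : Set (EuclideanSpace ℝ (Fin n)))
    (h : EuclideanSpace ℝ (Fin n) → ℝ) : Prop :=
  ContDiff ℝ (⊤ : ℕ∞) h ∧ HasCompactSupport h ∧ tsupport h ⊆ Ω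

/-- `u` is a weak solution of `Δu + Vu = 0` on `Ω`:
`∫_Ω u Δh + ∫_Ω V u h = 0` for every test function `h` on `Ω`. -/
def IsWeakSol {n : ℕ} (Ω : Set (EuclideanSpace ℝ (Fin n)))
    (V u : EuclideanSpace ℝ (Fin n) → ℝ) : Prop :=
  ∀ h, IsTestFun Ω h →
    (∫ x in Ω, u x * lap h x) + (∫ x in Ω, V x * u x * h x) = 0

/-- The supremum of `|u|` over a set `s`. -/
def supAbs {n : ℕ} (u : EuclideanSpace ℝ (Fin n) → ℝ) (s : Set (EuclideanSpace ℝ (Fin n))) : ℝ :=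
  sSup ((fun z => |u z|) '' s)

/-- A family of closed unit balls (given by their centers) is `L`-separated if any two distinct
balls of the family are at distance at least `L` from each other. -/
def UnitBallsSeparated {n : ℕ} {ι : Type} (c : ι → EuclideanSpace ℝ (Fin n)) (L : ℝ) : Prop :=
  ∀ i j, i ≠ j → ∀ x ∈ closedBall (c i) 1, ∀ y ∈ closedBall (c j) 1, L ≤ dist x y

/-- `u` is harmonic at every point of `s` (for `s` open this is usual harmonicity on `s`). -/
def HarmonicOnSet {n : ℕ} (u : EuclideanSpace ℝ (Fin n) → ℝ)
    (s : Set (EuclideanSpace ℝ (Fin n))) : Prop :=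
  ∀ x ∈ s, ContDiffAt ℝ 2 u x ∧ lap u x = 0

/-- `u` does not change sign on `s`. -/
def NoSignChange {n : ℕ} (u : EuclideanSpace ℝ (Fin n) → ℝ)
    (s : Set (EuclideanSpace ℝ (Fin n))) : Prop :=
  (∀ x ∈ s, 0 ≤ u x) ∨ (∀ x ∈ s, u x ≤ 0)

/-- The derivative of `f` in the direction `v`. -/
def dirDeriv (v : ℂ) (f : ℂ → ℝ) (z : ℂ) : ℝ := fderiv ℝ f z v

/-- The Laplacian on the complex plane, computed via iterated directional derivatives. -/
def planeLap (f : ℂ → ℝ) (z : ℂ) : ℝ :=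
  dirDeriv 1 (dirDeriv 1 f) z + dirDeriv Complex.I (dirDeriv Complex.I f) z

lemma ContDiffAt.dirDeriv {f : ℂ → ℝ} {z : ℂ} {n m : ℕ} (hf : ContDiffAt ℝ m f z)
    (h : n + 1 ≤ m) (v : ℂ) : ContDiffAt ℝ n (dirDeriv v f) z := by
  have h1 : ContDiffAt ℝ n (fderiv ℝ f) z := hf.fderiv_right (by exact_mod_cast h)
  exact h1.clm_apply contDiffAt_const

lemma ContDiff.dirDeriv {f : ℂ → ℝ} {n m : ℕ} (hf : ContDiff ℝ m f)
    (h : n + 1 ≤ m) (v : ℂ) : ContDiff ℝ n (dirDeriv v f) :=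
  contDiff_iff_contDiffAt.2 fun _ => hf.contDiffAt.dirDeriv h v

lemma HasCompactSupport.dirDeriv {f : ℂ → ℝ} (hf : HasCompactSupport f) (v : ℂ) :
    HasCompactSupport (dirDeriv v f) :=
  hf.fderiv_apply ℝ v

lemma dirDeriv_mul {f g : ℂ → ℝ} {z : ℂ} (v : ℂ) (hf : DifferentiableAt ℝ f z)
    (hg : DifferentiableAt ℝ g z) :
    dirDeriv v (fun y => f y * g y) z = dirDeriv v f z * g z + f z * dirDeriv v g z := by
  unfold dirDeriv
  rw [fderiv_fun_mul hf hg]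
  simp
  ring

lemma Filter.EventuallyEq.dirDeriv {f g : ℂ → ℝ} {z : ℂ} (v : ℂ) (h : f =ᶠ[𝓝 z] g) :
    dirDeriv v f =ᶠ[𝓝 z] dirDeriv v g := by
  filter_upwards [h.fderiv (𝕜 := ℝ)] with y hy
  simp [_root_.dirDeriv, hy]

lemma Filter.EventuallyEq.planeLap {f g : ℂ → ℝ} {z : ℂ} (h : f =ᶠ[𝓝 z] g) :
    planeLap f =ᶠ[𝓝 z] planeLap g := by
  filter_upwards [(h.dirDeriv 1).dirDeriv 1, (h.dirDeriv Complex.I).dirDeriv Complex.I]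
    with y h1 h2
  simp [_root_.planeLap, h1, h2]

lemma dirDeriv_dirDeriv_mul {f g : ℂ → ℝ} {z : ℂ} (v : ℂ) (hf : ContDiffAt ℝ 2 f z)
    (hg : ContDiffAt ℝ 2 g z) :
    dirDeriv v (dirDeriv v (fun y => f y * g y)) z =
      dirDeriv v (dirDeriv v f) z * g z + 2 * (dirDeriv v f z * dirDeriv v g z)
        + f z * dirDeriv v (dirDeriv v g) z := by
  have h1 : dirDeriv v (fun y => f y * g y) =ᶠ[𝓝 z]
      fun y => dirDeriv v f y * g y + f y * dirDeriv v g y := by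
    filter_upwards [hf.eventually (by simp), hg.eventually (by simp)] with y hfy hgy
    exact dirDeriv_mul v (hfy.differentiableAt (by simp)) (hgy.differentiableAt (by simp))
  have hf' : ContDiffAt ℝ (1 : ℕ) (dirDeriv v f) z :=
    ContDiffAt.dirDeriv (m := 2) (by exact_mod_cast hf) (by norm_num) v
  have hg' : ContDiffAt ℝ (1 : ℕ) (dirDeriv v g) z :=
    ContDiffAt.dirDeriv (m := 2) (by exact_mod_cast hg) (by norm_num) v
  have df := hf.differentiableAt (by simp)
  have dg := hg.differentiableAt (by simp)
  have df' := hf'.differentiableAt (by simp)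
  have dg' := hg'.differentiableAt (by simp)
  rw [(h1.dirDeriv v).eq_of_nhds]
  have h2 : dirDeriv v (fun y => dirDeriv v f y * g y + f y * dirDeriv v g y) z =
      dirDeriv v (fun y => dirDeriv v f y * g y) z
        + dirDeriv v (fun y => f y * dirDeriv v g y) z := by
    conv_lhs => unfold dirDeriv
    rw [fderiv_fun_add]
    · rfl
    · exact df'.mul dg
    · exact df.mul dg'
  rw [h2, dirDeriv_mul v df' dg, dirDeriv_mul v df dg']
  ring

lemma planeLap_mul {f g : ℂ → ℝ} {z : ℂ} (hf : ContDiffAt ℝ 2 f z) (hg : ContDiffAt ℝ 2 g z) :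
    planeLap (fun y => f y * g y) z = planeLap f z * g z
      + 2 * (dirDeriv 1 f z * dirDeriv 1 g z
        + dirDeriv Complex.I f z * dirDeriv Complex.I g z)
      + f z * planeLap g z := by
  unfold planeLap
  rw [dirDeriv_dirDeriv_mul _ hf hg, dirDeriv_dirDeriv_mul _ hf hg]
  ring

lemma dirDeriv_comm {f : ℂ → ℝ} {z : ℂ} (hf : ContDiffAt ℝ 2 f z) (v w : ℂ) :
    dirDeriv v (dirDeriv w f) z = dirDeriv w (dirDeriv v f) z := by
  have hd : DifferentiableAt ℝ (fderiv ℝ f) z :=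
    (hf.fderiv_right (m := 1) (by norm_num)).differentiableAt (by simp)
  have key (a b : ℂ) : dirDeriv a (dirDeriv b f) z = fderiv ℝ (fderiv ℝ f) z a b := by
    change fderiv ℝ (fun y => fderiv ℝ f y b) z a = _
    rw [fderiv_clm_apply hd (by fun_prop)]
    simp
  rw [key, key]
  exact (hf.isSymmSndFDerivAt (by simp)).eq v w

/-- The integral of a directional derivative of a compactly supported function vanishes. -/
lemma integral_dirDeriv_eq_zero {f : ℂ → ℝ} (hf : ContDiff ℝ (1 : ℕ) f)
    (hs : HasCompactSupport f) (v : ℂ) : ∫ z, dirDeriv v f z = 0 := by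
  have hc : Continuous (dirDeriv v f) := (hf.dirDeriv (n := 0) (by norm_num) v).continuous
  have : ∫ z, (1 : ℝ) * fderiv ℝ f z v = -∫ z, fderiv ℝ (fun _ : ℂ => (1 : ℝ)) z v * f z :=
    integral_mul_fderiv_eq_neg_fderiv_mul_of_integrable (by simp)
      (by simpa using! hc.integrable_of_hasCompactSupport (hs.dirDeriv v))
      (by simpa using hf.continuous.integrable_of_hasCompactSupport hs)
      (fun x _ => by fun_prop) (fun x _ => hf.differentiable (by simp) x)
  simpa [dirDeriv] using this

/-- A Carleman estimate for the Laplacian conjugated with a linear exponential weight. -/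
lemma carleman_conjugated {g : ℂ → ℝ} (hg : ContDiff ℝ 2 g) (hs : HasCompactSupport g) (k : ℝ) :
    4 * k ^ 2 * ∫ z, (dirDeriv 1 g z) ^ 2 ≤
      ∫ z, (planeLap g z + k ^ 2 * g z - 2 * k * dirDeriv 1 g z) ^ 2 := by
  set gx := dirDeriv 1 g with hgx
  set gy := dirDeriv Complex.I g with hgy
  have hg1 : ContDiff ℝ (1 : ℕ) g := hg.of_le (by norm_num)
  have hg2 : ContDiff ℝ (2 : ℕ) g := by exact_mod_cast hg
  have cx : ContDiff ℝ (1 : ℕ) gx := hg2.dirDeriv (by norm_num) 1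
  have cy : ContDiff ℝ (1 : ℕ) gy := hg2.dirDeriv (by norm_num) _
  have sx : HasCompactSupport gx := hs.dirDeriv 1
  have sy : HasCompactSupport gy := hs.dirDeriv _
  have dx := fun z => (cx.differentiable (by simp)) z
  have dy := fun z => (cy.differentiable (by simp)) z
  have dg := fun z => (hg1.differentiable (by simp)) z
  have cxx : Continuous (dirDeriv 1 gx) := (cx.dirDeriv (n := 0) (by norm_num) 1).continuous
  have cyy : Continuous (dirDeriv Complex.I gy) :=
    (cy.dirDeriv (n := 0) (by norm_num) _).continuous
  have cxc := cx.continuous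
  have cgc := hg1.continuous
  have z1 := integral_dirDeriv_eq_zero (cx.mul cx) (sx.mul_left) 1
  have z2 := integral_dirDeriv_eq_zero (cy.mul cx) (sx.mul_left) Complex.I
  have z3 := integral_dirDeriv_eq_zero (cy.mul cy) (sy.mul_left) 1
  have z4 := integral_dirDeriv_eq_zero (hg1.mul hg1) (hs.mul_left) 1
  have hibp {f : ℂ → ℝ} (hf : ContDiff ℝ (1 : ℕ) f) (hfs : HasCompactSupport f) (v : ℂ) :
      Integrable (dirDeriv v f) :=
    (hf.dirDeriv (n := 0) (by norm_num) v).continuous.integrable_of_hasCompactSupport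
      (hfs.dirDeriv v)
  have i1 := hibp (cx.mul cx) (sx.mul_left) 1
  have i2 := hibp (cy.mul cx) (sx.mul_left) Complex.I
  have i3 := hibp (cy.mul cy) (sy.mul_left) 1
  have i4 := hibp (hg1.mul hg1) (hs.mul_left) 1
  have hS : ∀ z, (planeLap g z + k ^ 2 * g z) * gx z =
      1 / 2 * dirDeriv 1 (fun y => gx y * gx y) z + dirDeriv Complex.I (fun y => gy y * gx y) z
      - 1 / 2 * dirDeriv 1 (fun y => gy y * gy y) z
      + k ^ 2 / 2 * dirDeriv 1 (fun y => g y * g y) z := by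
    intro z
    rw [dirDeriv_mul 1 (dx z) (dx z), dirDeriv_mul _ (dy z) (dx z),
      dirDeriv_mul _ (dy z) (dy z), dirDeriv_mul _ (dg z) (dg z)]
    have := dirDeriv_comm (z := z) hg.contDiffAt Complex.I 1
    simp only [← hgx, ← hgy] at this
    rw [this, planeLap, ← hgx, ← hgy]
    ring
  have hS0 : ∫ z, (planeLap g z + k ^ 2 * g z) * gx z = 0 := by
    simp_rw [hS]
    rw [integral_add, integral_sub, integral_add, integral_const_mul, integral_const_mul,
      integral_const_mul, z1, z2, z3, z4]
    · simp
    · exact i1.const_mul _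
    · exact i2
    · exact (i1.const_mul _).add i2
    · exact i3.const_mul _
    · exact ((i1.const_mul _).add i2).sub (i3.const_mul _)
    · exact i4.const_mul _
  have cS : Continuous fun z => planeLap g z + k ^ 2 * g z := by
    unfold planeLap; simp only [← hgx, ← hgy]; fun_prop
  have sS : HasCompactSupport fun z => planeLap g z + k ^ 2 * g z :=
    ((sx.dirDeriv 1).add (sy.dirDeriv _)).add hs.mul_left
  have j1 : Integrable fun z => (planeLap g z + k ^ 2 * g z) ^ 2 := by
    simp_rw [pow_two (planeLap g _ + _)]
    exact (cS.mul cS).integrable_of_hasCompactSupport sS.mul_left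
  have j2 : Integrable fun z => (planeLap g z + k ^ 2 * g z) * gx z :=
    (cS.mul cxc).integrable_of_hasCompactSupport sx.mul_left
  have j3 : Integrable fun z => gx z ^ 2 := by
    simp_rw [pow_two]
    exact (cxc.mul cxc).integrable_of_hasCompactSupport sx.mul_left
  have e : ∀ z, (planeLap g z + k ^ 2 * g z - 2 * k * gx z) ^ 2 =
      (planeLap g z + k ^ 2 * g z) ^ 2 - 4 * k * ((planeLap g z + k ^ 2 * g z) * gx z)
        + 4 * k ^ 2 * gx z ^ 2 := fun z => by ring
  simp_rw [e]
  have j4 : Integrable fun z => (planeLap g z + k ^ 2 * g z) ^ 2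
      - 4 * k * ((planeLap g z + k ^ 2 * g z) * gx z) := j1.sub (j2.const_mul _)
  rw [integral_add j4 (j3.const_mul _), integral_sub j1 (j2.const_mul _),
    integral_const_mul, integral_const_mul, hS0]
  have : 0 ≤ ∫ z, (planeLap g z + k ^ 2 * g z) ^ 2 := integral_nonneg fun z => sq_nonneg _
  linarith

lemma contDiff_exp_mul_re (k : ℝ) {n : WithTop ℕ∞} :
    ContDiff ℝ n fun z : ℂ => Real.exp (k * z.re) :=
  Real.contDiff_exp.comp (contDiff_const.mul Complex.reCLM.contDiff)

lemma dirDeriv_exp_mul_re (k : ℝ) (v z : ℂ) :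
    dirDeriv v (fun y : ℂ => Real.exp (k * y.re)) z = k * v.re * Real.exp (k * z.re) := by
  have h : HasFDerivAt (fun y : ℂ => Real.exp (k * y.re))
      (Real.exp (k * z.re) • (k • Complex.reCLM)) z :=
    (Complex.reCLM.hasFDerivAt.const_mul k).exp
  unfold dirDeriv
  rw [h.fderiv]
  simp
  ring

/-- A Carleman estimate for the Laplacian with a linear exponential weight. -/
lemma carleman {h : ℂ → ℝ} (hh : ContDiff ℝ 2 h) (hs : HasCompactSupport h) (k : ℝ) :
    4 * k ^ 2 * ∫ z, (dirDeriv 1 (fun y => Real.exp (k * y.re) * h y) z) ^ 2 ≤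
      ∫ z, Real.exp (2 * k * z.re) * (planeLap h z) ^ 2 := by
  have hE := contDiff_exp_mul_re k (n := 2)
  refine (carleman_conjugated (hE.mul hh) hs.mul_left k).trans (le_of_eq ?_)
  congr 1
  ext z
  have hexp : Real.exp (2 * k * z.re) = Real.exp (k * z.re) ^ 2 := by
    rw [← Real.exp_nat_mul]; ring_nf
  have hl : planeLap (fun y : ℂ => Real.exp (k * y.re)) z = k ^ 2 * Real.exp (k * z.re) := by
    have h1 (v : ℂ) : dirDeriv v (fun y : ℂ => Real.exp (k * y.re)) =
        fun y => k * v.re * Real.exp (k * y.re) := by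
      ext y; exact dirDeriv_exp_mul_re k v y
    have h2 (v : ℂ) : dirDeriv v (dirDeriv v (fun y : ℂ => Real.exp (k * y.re))) z =
        (k * v.re) ^ 2 * Real.exp (k * z.re) := by
      rw [h1, dirDeriv_mul v (by fun_prop) (hE.differentiable (by simp) z), dirDeriv_exp_mul_re]
      simp [dirDeriv]
      ring
    simp [planeLap, h2]
  rw [planeLap_mul hE.contDiffAt hh.contDiffAt, hl,
    dirDeriv_mul 1 (hE.differentiable (by simp) z) (hh.differentiable (by simp) z),
    dirDeriv_exp_mul_re, dirDeriv_exp_mul_re, hexp]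
  simp
  ring

/-- The squared integral is controlled by the integral of the square. -/
lemma sq_intervalIntegral_le {f : ℝ → ℝ} (hf : Continuous f) {s : ℝ} (hs : 0 ≤ s) :
    (∫ t in (0 : ℝ)..s, f t) ^ 2 ≤ s * ∫ t in (0 : ℝ)..s, f t ^ 2 := by
  rcases hs.eq_or_lt with rfl | hs
  · simp
  set m := ∫ t in (0 : ℝ)..s, f t with hm
  have h0 : 0 ≤ ∫ t in (0 : ℝ)..s, (s * f t - m) ^ 2 :=
    intervalIntegral.integral_nonneg hs.le fun t _ => sq_nonneg _
  have e : ∀ t, (s * f t - m) ^ 2 = s ^ 2 * f t ^ 2 - 2 * s * m * f t + m ^ 2 := fun t => by ring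
  simp_rw [e] at h0
  have c1 : Continuous fun t => s ^ 2 * f t ^ 2 := by fun_prop
  have c2 : Continuous fun t => 2 * s * m * f t := by fun_prop
  have c3 : Continuous fun t => s ^ 2 * f t ^ 2 - 2 * s * m * f t := c1.sub c2
  rw [intervalIntegral.integral_add (c3.intervalIntegrable _ _) (by simp),
    intervalIntegral.integral_sub (c1.intervalIntegrable _ _) (c2.intervalIntegrable _ _),
    intervalIntegral.integral_const_mul, intervalIntegral.integral_const_mul, ← hm] at h0
  simp only [intervalIntegral.integral_const, sub_zero, smul_eq_mul] at h0
  have : 0 ≤ s * (s * (∫ t in (0 : ℝ)..s, f t ^ 2) - m ^ 2) := by linarith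
  have := nonneg_of_mul_nonneg_right this hs
  linarith

/-- A Poincaré-type inequality along horizontal segments, for functions vanishing on a disk. -/
lemma setIntegral_sq_translate_le {g : ℂ → ℝ} (hg : ContDiff ℝ (1 : ℕ) g) {c : ℂ} {r s : ℝ}
    (hs : 0 ≤ s) (h0 : ∀ z ∈ ball c r, g z = 0) :
    ∫ z in ball c r, g (z + s) ^ 2 ≤ s ^ 2 * ∫ z in ball c (r + s), dirDeriv 1 g z ^ 2 := by
  have hφ : Continuous (dirDeriv 1 g) := (hg.dirDeriv (n := 0) (by norm_num) 1).continuous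
  set φ := dirDeriv 1 g with hφdef
  have hgc := hg.continuous
  have hpt : ∀ z ∈ ball c r, g (z + s) ^ 2 ≤ s * ∫ t in (0 : ℝ)..s, φ (z + t) ^ 2 := by
    intro z hz
    have hd : ∀ t : ℝ, HasDerivAt (fun t : ℝ => g (z + t)) (φ (z + t)) t := by
      intro t
      have h1 : HasDerivAt (fun t : ℝ => z + (t : ℂ)) 1 t :=
        (Complex.ofRealCLM.hasDerivAt (x := t)).const_add z
      exact ((hg.differentiable (by simp) (z + t)).hasFDerivAt).comp_hasDerivAt t h1
    have hc : Continuous fun t : ℝ => φ (z + t) := by fun_prop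
    have := intervalIntegral.integral_eq_sub_of_hasDerivAt (fun t _ => hd t)
      (hc.intervalIntegrable 0 s)
    simp only [Complex.ofReal_zero, add_zero, h0 z hz, sub_zero] at this
    rw [← this]
    exact sq_intervalIntegral_le hc hs
  have hprod : Integrable (Function.uncurry fun (z : ℂ) (t : ℝ) => φ (z + t) ^ 2)
      ((volume.restrict (ball c r)).prod (volume.restrict (Ioc 0 s))) := by
    rw [Measure.prod_restrict]
    have hc : Continuous (Function.uncurry fun (z : ℂ) (t : ℝ) => φ (z + t) ^ 2) := by
      unfold Function.uncurry; fun_prop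
    refine IntegrableOn.mono_set (t := closedBall c r ×ˢ Icc 0 s)
      (hc.continuousOn.integrableOn_compact
        ((isCompact_closedBall c r).prod isCompact_Icc))
      (prod_mono ball_subset_closedBall Ioc_subset_Icc_self)
  have hinner : ∀ t ∈ Ioc (0 : ℝ) s,
      ∫ z in ball c r, φ (z + t) ^ 2 ≤ ∫ z in ball c (r + s), φ z ^ 2 := by
    intro t ht
    have hsub : ball (c + t) r ⊆ ball c (r + s) := by
      refine ball_subset_ball' ?_
      simp [abs_of_pos ht.1, ht.2]
    have hpre : (fun z : ℂ => z + t) ⁻¹' ball (c + t) r = ball c r := by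
      ext z; simp
    have := (measurePreserving_add_right (volume : Measure ℂ) (t : ℂ)).setIntegral_preimage_emb
      (measurableEmbedding_addRight (t : ℂ)) (fun z => φ z ^ 2) (ball (c + t) r)
    rw [hpre] at this
    rw [this]
    refine setIntegral_mono_set ?_ (Eventually.of_forall fun z => sq_nonneg _)
      (hsub.eventuallyLE)
    exact (((hφ.pow 2).continuousOn).integrableOn_compact
      (isCompact_closedBall c (r + s))).mono_set ball_subset_closedBall
  have hgi : IntegrableOn (fun z : ℂ => g (z + s) ^ 2) (ball c r) := by
    have : Continuous (fun z : ℂ => g (z + s) ^ 2) := by fun_prop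
    exact (this.continuousOn.integrableOn_compact
      (isCompact_closedBall c r)).mono_set ball_subset_closedBall
  calc ∫ z in ball c r, g (z + s) ^ 2
      ≤ ∫ z in ball c r, s * ∫ t in Ioc 0 s, φ (z + t) ^ 2 := by
        refine setIntegral_mono_on hgi (hprod.integral_prod_left.const_mul s)
          measurableSet_ball fun z hz => ?_
        have := hpt z hz
        rwa [intervalIntegral.integral_of_le hs] at this
    _ = s * ∫ t in Ioc 0 s, ∫ z in ball c r, φ (z + t) ^ 2 := by
        rw [integral_const_mul, integral_integral_swap hprod]
    _ ≤ s * ∫ t in Ioc 0 s, ∫ z in ball c (r + s), φ z ^ 2 := by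
        refine mul_le_mul_of_nonneg_left ?_ hs
        refine setIntegral_mono_on hprod.integral_prod_right ?_ measurableSet_Ioc hinner
        exact (integrable_const _)
    _ = s ^ 2 * ∫ z in ball c (r + s), φ z ^ 2 := by
        simp [hs]
        ring

open InnerProductSpace in
lemma norm_fderiv_le_of_pos_harmonic {u : ℂ → ℝ} {z : ℂ} {r : ℝ} (hr : 0 < r)
    (hu : HarmonicOnNhd u (ball z r)) (hpos : ∀ w ∈ ball z r, 0 < u w) :
    ‖fderiv ℝ u z‖ ≤ 2 / r * u z := by
  obtain ⟨F, hF, hFu⟩ := hu.exists_analyticOnNhd_ball_re_eq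
  have hz : z ∈ ball z r := mem_ball_self hr
  set a := F z with ha
  have hare : a.re = u z := hFu hz
  have hne : ∀ w ∈ ball z r, F w + (starRingEnd ℂ) a ≠ 0 := by
    intro w hw h
    have h1 := congrArg Complex.re h
    have h2 : (F w).re = u w := hFu hw
    simp [h2, hare] at h1
    linarith [hpos w hw, hpos z hz]
  set G : ℂ → ℂ := fun w => (F w - a) / (F w + (starRingEnd ℂ) a) with hG
  have hGd : DifferentiableOn ℂ G (ball z r) := by
    intro w hw
    exact (((hF w hw).differentiableAt.sub_const a).div
      ((hF w hw).differentiableAt.add_const _) (hne w hw)).differentiableWithinAt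
  have hGz : G z = 0 := by simp [hG, ha]
  have hmaps : MapsTo G (ball z r) (closedBall (G z) 1) := by
    intro w hw
    rw [hGz, mem_closedBall_zero_iff, hG]
    simp only [norm_div]
    rw [div_le_one (norm_pos_iff.2 (hne w hw))]
    rw [← sq_le_sq₀ (norm_nonneg _) (norm_nonneg _), Complex.sq_norm, Complex.sq_norm,
      Complex.normSq_apply, Complex.normSq_apply]
    have h2 : (F w).re = u w := hFu hw
    simp [h2, hare]
    nlinarith [mul_pos (hpos w hw) (hpos z hz)]
  have hS := Complex.norm_deriv_le_div_of_mapsTo_ball hGd hmaps hr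
  have hFz := (hF z hz).differentiableAt.hasDerivAt
  have hsum : F z + (starRingEnd ℂ) a = ((2 * u z : ℝ) : ℂ) := by
    rw [← ha, Complex.add_conj, hare]
  have hu0 := hpos z hz
  have hdG : deriv G z = deriv F z / ((2 * u z : ℝ) : ℂ) := by
    have := ((hFz.sub_const a).div (hFz.add_const _) (hne z hz)).deriv
    rw [show deriv G z = _ from this, hsum, ← ha]
    have : ((2 * u z : ℝ) : ℂ) ≠ 0 := by
      exact_mod_cast (by positivity : (2 * u z) ≠ 0)
    field_simp
    simp
  have hbound : ‖deriv F z‖ ≤ 2 / r * u z := by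
    rw [hdG, norm_div, Complex.norm_real, Real.norm_of_nonneg (by positivity),
      div_le_div_iff₀ (by positivity) hr] at hS
    rw [div_mul_eq_mul_div, le_div_iff₀ hr]
    linarith
  have hfd : HasFDerivAt u (Complex.reCLM.comp
      ((ContinuousLinearMap.toSpanSingleton ℂ (deriv F z)).restrictScalars ℝ)) z := by
    have h1 := Complex.reCLM.hasFDerivAt.comp z (hFz.hasFDerivAt.restrictScalars ℝ)
    refine h1.congr_of_eventuallyEq ?_
    filter_upwards [isOpen_ball.mem_nhds hz] with w hw
    exact (hFu hw).symm
  rw [hfd.fderiv]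
  refine le_trans ?_ hbound
  refine ContinuousLinearMap.opNorm_le_bound _ (norm_nonneg _) fun x => ?_
  simp only [ContinuousLinearMap.comp_apply]
  refine (Complex.abs_re_le_norm _).trans ?_
  simp [mul_comm]

open InnerProductSpace in
/-- The gradient estimate for nonnegative harmonic functions. -/
lemma norm_fderiv_le_of_nonneg_harmonic {u : ℂ → ℝ} {z : ℂ} {r : ℝ} (hr : 0 < r)
    (hu : HarmonicOnNhd u (ball z r)) (hpos : ∀ w ∈ ball z r, 0 ≤ u w) :
    ‖fderiv ℝ u z‖ ≤ 2 / r * u z := by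
  have key : ∀ ε > 0, ‖fderiv ℝ u z‖ ≤ 2 / r * (u z + ε) := by
    intro ε hε
    have h1 : HarmonicOnNhd (u + fun _ => ε) (ball z r) :=
      hu.add fun x _ => harmonicAt_const ε
    have := norm_fderiv_le_of_pos_harmonic hr h1 fun w hw => by
      have := hpos w hw; simp; linarith
    have e : fderiv ℝ (u + fun _ => ε) z = fderiv ℝ u z := fderiv_add_const ε
    rwa [e] at this
  have ht : Tendsto (fun ε : ℝ => 2 / r * (u z + ε)) (𝓝[>] 0) (𝓝 (2 / r * (u z + 0))) :=
    ((continuous_const.mul (continuous_const.add continuous_id)).tendsto 0).mono_left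
      nhdsWithin_le_nhds
  rw [add_zero] at ht
  exact ge_of_tendsto ht (eventually_mem_nhdsWithin.mono fun ε hε => key ε hε)

open InnerProductSpace in
/-- The gradient estimate for bounded harmonic functions. -/
lemma norm_fderiv_le_of_bounded_harmonic {u : ℂ → ℝ} {z : ℂ} {r M : ℝ} (hr : 0 < r)
    (hu : HarmonicOnNhd u (ball z r)) (hM : ∀ w ∈ ball z r, |u w| ≤ M) :
    ‖fderiv ℝ u z‖ ≤ 4 * M / r := by
  have h1 : HarmonicOnNhd (u + fun _ => M) (ball z r) :=
    hu.add fun x _ => harmonicAt_const M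
  have := norm_fderiv_le_of_nonneg_harmonic hr h1 fun w hw => by
    have := neg_le_of_abs_le (hM w hw); simp; linarith
  have e : fderiv ℝ (u + fun _ => M) z = fderiv ℝ u z := fderiv_add_const M
  rw [e] at this
  refine this.trans ?_
  have := le_of_abs_le (hM z (mem_ball_self hr))
  rw [div_mul_eq_mul_div]
  refine div_le_div_of_nonneg_right ?_ hr.le
  simp only [Pi.add_apply]
  linarith

open InnerProductSpace in
/-- Harnack's inequality on an annulus. -/
lemma exists_harnack_annulus {ε : ℝ} (hε : 0 < ε) (hε4 : ε < 4) :
    ∃ C : ℝ, 1 ≤ C ∧ ∀ (u : ℂ → ℝ) (c : ℂ),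
      HarmonicOnNhd u (ball c 5 \ closedBall c 1) →
      (∀ z ∈ ball c 5 \ closedBall c 1, 0 ≤ u z) →
      ∀ z w : ℂ, ‖z - c‖ ∈ Icc (1 + ε) (5 - ε) → ‖w - c‖ ∈ Icc (1 + ε) (5 - ε) →
        u z ≤ C * u w := by
  set K : ℝ := 2 / ε * (5 * (Real.log 5 + 2 * Real.pi)) with hK
  have hl5 : 0 < Real.log 5 := Real.log_pos (by norm_num)
  have hK0 : 0 ≤ K := by positivity
  refine ⟨Real.exp K, Real.one_le_exp hK0, fun u c hu hpos z w hz hw => ?_⟩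
  have hz0 : z - c ≠ 0 := norm_pos_iff.1 (by linarith [hz.1])
  have hw0 : w - c ≠ 0 := norm_pos_iff.1 (by linarith [hw.1])
  set p := Complex.log (z - c) with hp
  set q := Complex.log (w - c) with hq
  have hpre : p.re = Real.log ‖z - c‖ := Complex.log_re _
  have hqre : q.re = Real.log ‖w - c‖ := Complex.log_re _
  set γ : ℝ → ℂ := fun t => c + Complex.exp (p + t * (q - p)) with hγ
  have hγ0 : γ 0 = z := by simp [hγ, hp, Complex.exp_log hz0]
  have hγ1 : γ 1 = w := by simp [hγ, hq, Complex.exp_log hw0]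
  have hγn : ∀ t ∈ Icc (0 : ℝ) 1, ‖γ t - c‖ ∈ Icc (1 + ε) (5 - ε) := by
    intro t ht
    have e : ‖γ t - c‖ = Real.exp ((1 - t) * p.re + t * q.re) := by
      simp [hγ, Complex.norm_exp]; ring
    have z1 := Real.log_le_log (by linarith) hz.1
    have z2 := Real.log_le_log (by linarith [hz.1]) hz.2
    have w1 := Real.log_le_log (by linarith) hw.1
    have w2 := Real.log_le_log (by linarith [hw.1]) hw.2
    rw [← hpre] at z1 z2
    rw [← hqre] at w1 w2
    rw [e]
    constructor
    · rw [← Real.log_le_iff_le_exp (by linarith)]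
      nlinarith [ht.1, ht.2]
    · rw [← Real.le_log_iff_exp_le (by linarith)]
      nlinarith [ht.1, ht.2]
  have hqp : ‖q - p‖ ≤ Real.log 5 + 2 * Real.pi := by
    refine (Complex.norm_le_abs_re_add_abs_im _).trans (add_le_add ?_ ?_)
    · rw [Complex.sub_re, hpre, hqre, abs_le]
      have z1 := Real.log_nonneg (by linarith [hz.1] : 1 ≤ ‖z - c‖)
      have z2 := Real.log_le_log (by linarith [hz.1]) (by linarith [hz.2] : ‖z - c‖ ≤ 5)
      have w1 := Real.log_nonneg (by linarith [hw.1] : 1 ≤ ‖w - c‖)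
      have w2 := Real.log_le_log (by linarith [hw.1]) (by linarith [hw.2] : ‖w - c‖ ≤ 5)
      constructor <;> linarith
    · rw [Complex.sub_im, hp, hq, Complex.log_im, Complex.log_im, abs_le]
      have := Complex.neg_pi_lt_arg (z - c)
      have := Complex.neg_pi_lt_arg (w - c)
      have := Complex.arg_le_pi (z - c)
      have := Complex.arg_le_pi (w - c)
      constructor <;> linarith
  have hγd : ∀ t : ℝ, HasDerivAt γ (Complex.exp (p + t * (q - p)) * (q - p)) t := by
    intro t
    have h1 : HasDerivAt (fun t : ℝ => p + (t : ℂ) * (q - p)) (q - p) t := by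
      simpa using! ((Complex.ofRealCLM.hasDerivAt (x := t)).mul_const (q - p)).const_add p
    exact h1.cexp.const_add c
  have hball : ∀ t ∈ Icc (0 : ℝ) 1, ball (γ t) ε ⊆ ball c 5 \ closedBall c 1 := by
    intro t ht y hy
    have h1 := hγn t ht
    rw [mem_ball_iff_norm] at hy
    rw [Set.mem_sdiff, mem_ball_iff_norm, mem_closedBall_iff_norm, not_le]
    have a1 := norm_sub_le_norm_sub_add_norm_sub y (γ t) c
    have a2 := norm_sub_le_norm_sub_add_norm_sub (γ t) y c
    rw [norm_sub_rev (γ t) y] at a2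
    constructor <;> linarith [h1.1, h1.2]
  have hgrad : ∀ t ∈ Icc (0 : ℝ) 1, ‖fderiv ℝ u (γ t)‖ ≤ 2 / ε * u (γ t) := fun t ht =>
    norm_fderiv_le_of_nonneg_harmonic hε (hu.mono (hball t ht))
      fun y hy => hpos y (hball t ht hy)
  have hφd : ∀ t ∈ Icc (0 : ℝ) 1, HasDerivAt (fun t => u (γ t) * Real.exp (K * t))
      (fderiv ℝ u (γ t) (Complex.exp (p + t * (q - p)) * (q - p)) * Real.exp (K * t)
        + u (γ t) * (Real.exp (K * t) * K)) t := by
    intro t ht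
    have hud : DifferentiableAt ℝ u (γ t) :=
      (hu _ (hball t ht (mem_ball_self hε))).1.differentiableAt (by simp)
    have h2 : HasDerivAt (fun t : ℝ => Real.exp (K * t)) (Real.exp (K * t) * K) t := by
      simpa using! ((hasDerivAt_id t).const_mul K).exp
    exact (hud.hasFDerivAt.comp_hasDerivAt t (hγd t)).mul h2
  have hmono : MonotoneOn (fun t => u (γ t) * Real.exp (K * t)) (Icc 0 1) := by
    refine monotoneOn_of_deriv_nonneg (convex_Icc 0 1)
      (fun t ht => (hφd t ht).continuousAt.continuousWithinAt)
      (fun t ht => ((hφd t (interior_subset ht)).differentiableAt).differentiableWithinAt)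
      fun t ht => ?_
    have ht' := interior_subset ht
    rw [(hφd t ht').deriv]
    have hn : ‖Complex.exp (p + t * (q - p)) * (q - p)‖ ≤ 5 * (Real.log 5 + 2 * Real.pi) := by
      rw [norm_mul]
      have h5 : ‖Complex.exp (p + t * (q - p))‖ ≤ 5 := by
        have := (hγn t ht').2
        simp only [hγ, add_sub_cancel_left] at this
        linarith
      gcongr
    have h3 := (fderiv ℝ u (γ t)).le_opNorm (Complex.exp (p + t * (q - p)) * (q - p))
    have h4 := hgrad t ht'
    have h0 : 0 ≤ u (γ t) := hpos _ (hball t ht' (mem_ball_self hε))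
    have h5 : ‖fderiv ℝ u (γ t) (Complex.exp (p + t * (q - p)) * (q - p))‖ ≤ K * u (γ t) := by
      refine h3.trans ((mul_le_mul h4 hn (norm_nonneg _) (by positivity)).trans (le_of_eq ?_))
      rw [hK]; ring
    have h6 := neg_le_of_abs_le h5
    nlinarith [Real.exp_pos (K * t)]
  have := hmono (left_mem_Icc.2 zero_le_one) (right_mem_Icc.2 zero_le_one) zero_le_one
  simp only [hγ0, hγ1, mul_zero, Real.exp_zero, mul_one] at this
  linarith

/-- Uniform bounds for a function, its first derivatives and its Laplacian. -/
def DerivBounds (B : ℝ) (f : ℂ → ℝ) : Prop :=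
  ∀ z, |f z| ≤ B ∧ |dirDeriv 1 f z| ≤ B ∧ |dirDeriv Complex.I f z| ≤ B ∧ |planeLap f z| ≤ B

lemma exists_derivBounds {f : ℂ → ℝ} (hf : ContDiff ℝ 2 f) (hs : HasCompactSupport f) :
    ∃ B, DerivBounds B f := by
  have hf2 : ContDiff ℝ (2 : ℕ) f := by exact_mod_cast hf
  have c1 (v : ℂ) : ContDiff ℝ (1 : ℕ) (dirDeriv v f) := hf2.dirDeriv (by norm_num) v
  have c2 (v : ℂ) : Continuous (dirDeriv v (dirDeriv v f)) :=
    ((c1 v).dirDeriv (n := 0) (by norm_num) v).continuous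
  obtain ⟨B0, h0⟩ := hs.exists_bound_of_continuous hf.continuous
  obtain ⟨B1, h1⟩ := (hs.dirDeriv 1).exists_bound_of_continuous (c1 1).continuous
  obtain ⟨B2, h2⟩ := (hs.dirDeriv Complex.I).exists_bound_of_continuous (c1 Complex.I).continuous
  obtain ⟨B3, h3⟩ := HasCompactSupport.exists_bound_of_continuous
    (((hs.dirDeriv 1).dirDeriv 1).add ((hs.dirDeriv Complex.I).dirDeriv Complex.I))
    ((c2 1).add (c2 Complex.I))
  refine ⟨max (max B0 B1) (max B2 B3), fun z => ⟨?_, ?_, ?_, ?_⟩⟩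
  · exact (h0 z).trans ((le_max_left _ _).trans (le_max_left _ _))
  · exact (h1 z).trans ((le_max_right _ _).trans (le_max_left _ _))
  · exact (h2 z).trans ((le_max_left _ _).trans (le_max_right _ _))
  · exact (h3 z).trans ((le_max_right _ _).trans (le_max_right _ _))

lemma dirDeriv_comp_sub (f : ℂ → ℝ) (a v : ℂ) :
    dirDeriv v (fun z => f (z - a)) = fun z => dirDeriv v f (z - a) := by
  ext z
  simp [dirDeriv, fderiv_comp_sub]

lemma dirDeriv_const_mul (f : ℂ → ℝ) (r : ℝ) (v : ℂ) :
    dirDeriv v (fun z => r * f z) = fun z => r * dirDeriv v f z := by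
  ext z
  have : fderiv ℝ (r • f) = r • fderiv ℝ f := fderiv_const_smul_field r
  change fderiv ℝ (r • f) z v = _
  rw [this]
  rfl

lemma dirDeriv_comp_smul (f : ℂ → ℝ) (r : ℝ) (v : ℂ) :
    dirDeriv v (fun z => f (r • z)) = fun z => r * dirDeriv v f (r • z) := by
  ext z
  have : fderiv ℝ (fun z => f (r • z)) z = r • fderiv ℝ f (r • z) := fderiv_comp_smul (f := f) r
  simp only [dirDeriv]
  rw [this]
  rfl

lemma dirDeriv_one_sub (f : ℂ → ℝ) (v : ℂ) :
    dirDeriv v (fun z => 1 - f z) = fun z => -1 * dirDeriv v f z := by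
  ext z
  simp [dirDeriv, fderiv_const_sub]

lemma DerivBounds.comp_sub {B : ℝ} {f : ℂ → ℝ} (h : DerivBounds B f) (a : ℂ) :
    DerivBounds B fun z => f (z - a) := by
  intro z
  simpa [planeLap, dirDeriv_comp_sub] using! h (z - a)

lemma DerivBounds.one_sub {B : ℝ} {f : ℂ → ℝ} (h : DerivBounds B f) :
    DerivBounds (1 + B) fun z => 1 - f z := by
  intro z
  obtain ⟨h0, h1, h2, h3⟩ := h z
  refine ⟨(abs_sub _ _).trans (by simpa using h0), ?_, ?_, ?_⟩
  · rw [dirDeriv_one_sub, abs_mul]; simp; linarith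
  · rw [dirDeriv_one_sub, abs_mul]; simp; linarith
  · rw [planeLap, dirDeriv_one_sub, dirDeriv_one_sub, dirDeriv_const_mul, dirDeriv_const_mul,
      ← mul_add, abs_mul]
    change |-1| * |planeLap f z| ≤ _
    simp; linarith

lemma DerivBounds.comp_smul {B : ℝ} {f : ℂ → ℝ} (h : DerivBounds B f) {r : ℝ} (hr : 0 ≤ r)
    (hr1 : r ≤ 1) : DerivBounds B fun z => f (r • z) := by
  intro z
  obtain ⟨h0, h1, h2, h3⟩ := h (r • z)
  have key : ∀ x : ℝ, |x| ≤ B → |r * x| ≤ B := fun x hx => by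
    rw [abs_mul, abs_of_nonneg hr]
    nlinarith [abs_nonneg x]
  refine ⟨h0, ?_, ?_, ?_⟩
  · rw [dirDeriv_comp_smul]; exact key _ h1
  · rw [dirDeriv_comp_smul]; exact key _ h2
  · have hl : planeLap (fun z => f (r • z)) z = r * (r * planeLap f (r • z)) := by
      simp only [planeLap, dirDeriv_comp_smul, dirDeriv_const_mul]
      ring
    rw [hl]
    exact key _ (key _ h3)

lemma DerivBounds.mul {A B : ℝ} {f g : ℂ → ℝ} (hf : DerivBounds A f) (hg : DerivBounds B g)
    (hfc : ContDiff ℝ 2 f) (hgc : ContDiff ℝ 2 g) :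
    DerivBounds (6 * (A * B)) fun z => f z * g z := by
  intro z
  obtain ⟨f0, f1, f2, f3⟩ := hf z
  obtain ⟨g0, g1, g2, g3⟩ := hg z
  have hA : 0 ≤ A := (abs_nonneg _).trans f0
  have hB : 0 ≤ B := (abs_nonneg _).trans g0
  have hAB : 0 ≤ A * B := mul_nonneg hA hB
  have key : ∀ x y : ℝ, |x| ≤ A → |y| ≤ B → |x * y| ≤ A * B := fun x y hx hy => by
    rw [abs_mul]; gcongr
  have df := hfc.differentiable (by simp) z
  have dg := hgc.differentiable (by simp) z
  refine ⟨?_, ?_, ?_, ?_⟩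
  · have := key _ _ f0 g0; linarith
  · rw [dirDeriv_mul _ df dg]
    refine (abs_add_le _ _).trans ?_
    linarith [key _ _ f1 g0, key _ _ f0 g1]
  · rw [dirDeriv_mul _ df dg]
    refine (abs_add_le _ _).trans ?_
    linarith [key _ _ f2 g0, key _ _ f0 g2]
  · rw [planeLap_mul hfc.contDiffAt hgc.contDiffAt]
    have k1 := abs_le.1 (key _ _ f3 g0)
    have k2 := abs_le.1 (key _ _ f1 g1)
    have k3 := abs_le.1 (key _ _ f2 g2)
    have k4 := abs_le.1 (key _ _ f0 g3)
    rw [abs_le]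
    constructor <;> linarith [k1.1, k1.2, k2.1, k2.2, k3.1, k3.2, k4.1, k4.2]

lemma DerivBounds.congr_at {B : ℝ} {f g : ℂ → ℝ} {z : ℂ} (hg : DerivBounds B g)
    (h : f =ᶠ[𝓝 z] g) :
    |f z| ≤ B ∧ |dirDeriv 1 f z| ≤ B ∧ |dirDeriv Complex.I f z| ≤ B ∧ |planeLap f z| ≤ B := by
  rw [h.eq_of_nhds, (h.dirDeriv 1).eq_of_nhds, (h.dirDeriv Complex.I).eq_of_nhds,
    h.planeLap.eq_of_nhds]
  exact hg z

lemma DerivBounds.mono {A B : ℝ} {f : ℂ → ℝ} (h : DerivBounds A f) (hAB : A ≤ B) :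
    DerivBounds B f := fun z =>
  ⟨(h z).1.trans hAB, (h z).2.1.trans hAB, (h z).2.2.1.trans hAB, (h z).2.2.2.trans hAB⟩

/-- Smooth cutoffs removing a finite separated family of disks and a neighbourhood of infinity,
with uniformly bounded derivatives. -/
lemma exists_cutoff : ∃ B : ℝ, 0 < B ∧ ∀ (ι : Type) (c : ι → ℂ),
    (∀ i j, i ≠ j → 100 ≤ dist (c i) (c j)) → ∀ (J : Finset ι) (R : ℝ), 1 ≤ R →
    ∃ w : ℂ → ℝ, ContDiff ℝ 2 w ∧ HasCompactSupport w ∧ DerivBounds B w ∧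
      (∀ i ∈ J, ∀ z, dist z (c i) < 2 → w =ᶠ[𝓝 z] 0) ∧
      (∀ z, 3 * R < ‖z‖ → w =ᶠ[𝓝 z] 0) ∧
      (∀ z, ‖z‖ < 2 * R → (∀ i ∈ J, 3 < dist z (c i)) → w =ᶠ[𝓝 z] 1) := by
  let β : ContDiffBump (0 : ℂ) := ⟨2, 3, by norm_num, by norm_num⟩
  have hβ : ContDiff ℝ 2 β := β.contDiff
  obtain ⟨B, hB⟩ := exists_derivBounds hβ β.hasCompactSupport
  have hB0 : 0 ≤ B := (abs_nonneg _).trans (hB 0).1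
  have hone : ∀ z : ℂ, ‖z‖ ≤ 2 → β z = 1 := fun z hz =>
    β.one_of_mem_closedBall (by simpa using hz)
  have hzero : ∀ z : ℂ, 3 ≤ ‖z‖ → β z = 0 := fun z hz =>
    β.zero_of_le_dist (by simpa using hz)
  refine ⟨6 * ((1 + B) * (1 + B)), by positivity, fun ι c hsep J R hR => ?_⟩
  have hR0 : 0 < R := by linarith
  set χ : ℂ → ℝ := fun z => 1 - ∑ i ∈ J, β (z - c i) with hχ
  have hχc : ContDiff ℝ 2 χ :=
    contDiff_const.sub (ContDiff.sum fun i _ => hβ.comp (contDiff_id.sub contDiff_const))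
  have hθc : ContDiff ℝ 2 fun z : ℂ => β (R⁻¹ • z) := hβ.comp (contDiff_const_smul _)
  have hθs : HasCompactSupport fun z : ℂ => β (R⁻¹ • z) := by
    have := β.hasCompactSupport.comp_homeomorph (Homeomorph.smulOfNeZero R⁻¹ (by positivity))
    exact this
  have hfar : ∀ z, (∀ i ∈ J, 3 < dist z (c i)) → χ =ᶠ[𝓝 z] fun _ => 1 := by
    intro z hz
    have : ∀ᶠ y in 𝓝 z, ∀ i ∈ J, 3 < dist y (c i) := by
      rw [Filter.eventually_all_finset]
      exact fun i hi => (continuous_id.dist continuous_const).continuousAt.eventually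
        (lt_mem_nhds (hz i hi))
    filter_upwards [this] with y hy
    simp only [hχ]
    rw [Finset.sum_eq_zero, sub_zero]
    intro i hi
    exact hzero _ (by rw [← dist_eq_norm]; exact (hy i hi).le)
  have hnear : ∀ i ∈ J, ∀ z, dist z (c i) < 5 → χ =ᶠ[𝓝 z] fun y => 1 - β (y - c i) := by
    intro i hi z hz
    filter_upwards [isOpen_ball.mem_nhds (mem_ball.2 hz)] with y hy
    simp only [hχ]
    rw [Finset.sum_eq_single_of_mem i hi]
    intro j hj hji
    refine hzero _ ?_
    rw [← dist_eq_norm]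
    have h1 := hsep i j hji.symm
    have h2 := dist_triangle (c i) y (c j)
    rw [mem_ball, dist_comm] at hy
    linarith
  have hχB : DerivBounds (1 + B) χ := by
    intro z
    by_cases h : ∃ i ∈ J, dist z (c i) < 5
    · obtain ⟨i, hi, hz⟩ := h
      exact (hB.comp_sub (c i)).one_sub.congr_at (hnear i hi z hz)
    · push Not at h
      have h1 : DerivBounds (1 + B) fun _ : ℂ => (1 : ℝ) := by
        intro z
        have h0 : dirDeriv (1 : ℂ) (fun _ : ℂ => (1 : ℝ)) = fun _ => 0 := by
          ext; simp [dirDeriv]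
        have h0' : dirDeriv Complex.I (fun _ : ℂ => (1 : ℝ)) = fun _ => 0 := by
          ext; simp [dirDeriv]
        have h2 (v : ℂ) : dirDeriv v (fun _ : ℂ => (0 : ℝ)) = fun _ => 0 := by
          ext; simp [dirDeriv]
        simp only [planeLap, h0, h0', h2, abs_one, abs_zero, add_zero]
        refine ⟨?_, ?_, ?_, ?_⟩ <;> linarith
      exact h1.congr_at (hfar z fun i hi => by linarith [h i hi])
  refine ⟨fun z => β (R⁻¹ • z) * χ z, hθc.mul hχc, hθs.mul_right,
    ((hB.comp_smul (by positivity) (inv_le_one_of_one_le₀ hR)).mono (by linarith)).mul hχB hθc hχc,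
    ?_, ?_, ?_⟩
  · intro i hi z hz
    filter_upwards [hnear i hi z (by linarith), isOpen_ball.mem_nhds (mem_ball.2 hz)] with y h1 h2
    rw [h1, hone (y - c i) (by rw [← dist_eq_norm]; exact (mem_ball.1 h2).le)]
    simp
  · intro z hz
    filter_upwards [continuous_norm.continuousAt.eventually (lt_mem_nhds hz)] with y hy
    rw [hzero]
    · simp
    · rw [norm_smul, Real.norm_of_nonneg (by positivity), inv_mul_eq_div, le_div_iff₀ hR0]
      exact hy.le
  · intro z hz hJ
    filter_upwards [hfar z hJ, continuous_norm.continuousAt.eventually (gt_mem_nhds hz)]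
      with y h1 hy
    rw [hone, h1]
    · simp
    · rw [norm_smul, Real.norm_of_nonneg (by positivity), inv_mul_eq_div, div_le_iff₀ hR0]
      exact hy.le

open InnerProductSpace in
lemma laplacian_eq_planeLap {u : ℂ → ℝ} {z : ℂ} (hu : ContDiffAt ℝ 2 u z) :
    Laplacian.laplacian u z = planeLap u z := by
  have hd : DifferentiableAt ℝ (fderiv ℝ u) z :=
    (hu.fderiv_right (m := 1) (by norm_num)).differentiableAt (by simp)
  have key (a : ℂ) : dirDeriv a (dirDeriv a u) z = fderiv ℝ (fderiv ℝ u) z a a := by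
    change fderiv ℝ (fun y => fderiv ℝ u y a) z a = _
    rw [fderiv_clm_apply hd (by fun_prop)]
    simp
  rw [laplacian_eq_iteratedFDeriv_complexPlane]
  simp [planeLap, key, iteratedFDeriv_two_apply]

lemma planeLap_eq_zero_of_harmonicAt {u : ℂ → ℝ} {z : ℂ} (hu : InnerProductSpace.HarmonicAt u z) :
    planeLap u z = 0 := by
  rw [← laplacian_eq_planeLap hu.1]
  exact hu.2.eq_of_nhds

open InnerProductSpace in
/-- Pointwise bound for the Laplacian of a harmonic function multiplied by a cutoff. -/
lemma abs_planeLap_mul_cutoff_le {u w : ℂ → ℝ} {z : ℂ} {B : ℝ} (hu : HarmonicAt u z)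
    (hw : ContDiff ℝ 2 w) (hB : DerivBounds B w) :
    |planeLap (fun y => u y * w y) z| ≤ B * (4 * ‖fderiv ℝ u z‖ + |u z|) := by
  obtain ⟨w0, w1, w2, w3⟩ := hB z
  rw [planeLap_mul hu.1 hw.contDiffAt, planeLap_eq_zero_of_harmonicAt hu, zero_mul, zero_add]
  have d1 : |dirDeriv 1 u z| ≤ ‖fderiv ℝ u z‖ := by
    simpa using! (fderiv ℝ u z).le_opNorm 1
  have d2 : |dirDeriv Complex.I u z| ≤ ‖fderiv ℝ u z‖ := by
    simpa using! (fderiv ℝ u z).le_opNorm Complex.I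
  have key : ∀ x y X : ℝ, |x| ≤ X → |y| ≤ B → |x * y| ≤ X * B := fun x y X hx hy => by
    have : 0 ≤ X := (abs_nonneg _).trans hx
    rw [abs_mul]; gcongr
  have k1 := abs_le.1 (key _ _ _ d1 w1)
  have k2 := abs_le.1 (key _ _ _ d2 w2)
  have k3 := abs_le.1 (key (u z) (planeLap w z) |u z| le_rfl w3)
  rw [abs_le]
  constructor <;> linarith [k1.1, k1.2, k2.1, k2.2, k3.1, k3.2]

open InnerProductSpace in
/-- Harnack and gradient bounds for a harmonic function without sign change on an annulus. -/
lemma exists_annulus_bounds : ∃ C : ℝ, 1 ≤ C ∧ ∀ (u : ℂ → ℝ) (c : ℂ),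
    HarmonicOnNhd u (ball c 5 \ closedBall c 1) →
    ((∀ z ∈ ball c 5 \ closedBall c 1, 0 ≤ u z) ∨ (∀ z ∈ ball c 5 \ closedBall c 1, u z ≤ 0)) →
    (∀ z w : ℂ, ‖z - c‖ ∈ Icc 2 4 → ‖w - c‖ ∈ Icc 2 4 → |u z| ≤ C * |u w|) ∧
    (∀ z : ℂ, ‖z - c‖ ∈ Icc 2 4 → ‖fderiv ℝ u z‖ ≤ 2 * |u z|) := by
  obtain ⟨C, hC, h⟩ := exists_harnack_annulus (ε := 1) (by norm_num) (by norm_num)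
  refine ⟨C, hC, fun u c hu hs => ?_⟩
  have main : ∀ v : ℂ → ℝ, HarmonicOnNhd v (ball c 5 \ closedBall c 1) →
      (∀ z ∈ ball c 5 \ closedBall c 1, 0 ≤ v z) →
      (∀ z w : ℂ, ‖z - c‖ ∈ Icc 2 4 → ‖w - c‖ ∈ Icc 2 4 → |v z| ≤ C * |v w|) ∧
      (∀ z : ℂ, ‖z - c‖ ∈ Icc 2 4 → ‖fderiv ℝ v z‖ ≤ 2 * |v z|) := by
    intro v hv hp
    have hmem : ∀ z : ℂ, ‖z - c‖ ∈ Icc 2 4 → z ∈ ball c 5 \ closedBall c 1 := by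
      intro z hz
      rw [Set.mem_sdiff, mem_ball_iff_norm, mem_closedBall_iff_norm, not_le]
      constructor <;> linarith [hz.1, hz.2]
    constructor
    · intro z w hz hw
      rw [abs_of_nonneg (hp z (hmem z hz)), abs_of_nonneg (hp w (hmem w hw))]
      refine h v c hv hp z w ?_ ?_
      · convert hz using 2 <;> norm_num
      · convert hw using 2 <;> norm_num
    · intro z hz
      have hb : ball z 1 ⊆ ball c 5 \ closedBall c 1 := by
        intro y hy
        rw [mem_ball_iff_norm] at hy
        rw [Set.mem_sdiff, mem_ball_iff_norm, mem_closedBall_iff_norm, not_le]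
        have a1 := norm_sub_le_norm_sub_add_norm_sub y z c
        have a2 := norm_sub_le_norm_sub_add_norm_sub z y c
        rw [norm_sub_rev z y] at a2
        constructor <;> linarith [hz.1, hz.2]
      have := norm_fderiv_le_of_nonneg_harmonic one_pos (hv.mono hb) fun y hy => hp y (hb hy)
      rw [abs_of_nonneg (hp z (hmem z hz))]
      linarith
  rcases hs with hs | hs
  · exact main u hu hs
  · have := main (-u) hu.neg fun z hz => by simpa using hs z hz
    simpa [fderiv_neg] using this

lemma integrable_decay : Integrable fun z : ℂ => ((1 + ‖z‖) ^ 3)⁻¹ := by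
  have h := integrable_one_add_norm (E := ℂ) (μ := volume) (r := 3) (by
    rw [Complex.finrank_real_complex]; norm_num)
  refine h.congr (Eventually.of_forall fun z => ?_)
  have : 0 ≤ 1 + ‖z‖ := by positivity
  simp only
  rw [Real.rpow_neg this]
  norm_cast

/-- Integrals over disjoint balls of a nonnegative function add up to at most its total integral. -/
lemma sum_setIntegral_ball_le {ι : Type} {c : ι → ℂ}
    (hsep : ∀ i j, i ≠ j → 100 ≤ dist (c i) (c j)) {r : ℝ} (hr : r ≤ 50) {f : ℂ → ℝ}
    (hf : Integrable f) (h0 : ∀ z, 0 ≤ f z) (J : Finset ι) :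
    ∑ i ∈ J, ∫ z in ball (c i) r, f z ≤ ∫ z, f z := by
  rw [← integral_biUnion_finset J (fun i _ => measurableSet_ball) ?_
    (fun i _ => hf.integrableOn)]
  · exact setIntegral_le_integral hf (Eventually.of_forall h0)
  · intro i _ j _ hij
    exact ball_disjoint_ball (by linarith [hsep i j hij])

lemma volume_real_ball (a : ℂ) {r : ℝ} (hr : 0 ≤ r) :
    (volume : Measure ℂ).real (ball a r) = r ^ 2 * Real.pi := by
  rw [Measure.real, Complex.volume_ball]
  simp [ENNReal.toReal_mul, hr]

/-- A lower bound on a ball gives a lower bound on the integral. -/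
lemma mul_le_setIntegral_ball {f : ℂ → ℝ} (hf : Continuous f) (a : ℂ) {r m : ℝ} (hr : 0 ≤ r)
    (h : ∀ z ∈ ball a r, m ≤ f z) : r ^ 2 * Real.pi * m ≤ ∫ z in ball a r, f z := by
  rw [← volume_real_ball a hr, ← smul_eq_mul, ← setIntegral_const]
  refine setIntegral_mono_on ?_ ?_ measurableSet_ball h
  · exact integrableOn_const measure_ball_lt_top.ne
  · exact (hf.continuousOn.integrableOn_compact (isCompact_closedBall a r)).mono_set
      ball_subset_closedBall

lemma summable_decay {ι : Type} {c : ι → ℂ}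
    (hsep : ∀ i j, i ≠ j → 100 ≤ dist (c i) (c j)) :
    Summable fun i => ((1 + ‖c i‖) ^ 3)⁻¹ := by
  refine summable_of_sum_le (c := 8 * ∫ z : ℂ, ((1 + ‖z‖) ^ 3)⁻¹) (fun i => by positivity)
    fun J => ?_
  have h := sum_setIntegral_ball_le hsep (r := 1) (by norm_num) integrable_decay
    (fun z => by positivity) J
  refine le_trans ?_ (mul_le_mul_of_nonneg_left h (by norm_num))
  rw [Finset.mul_sum]
  refine Finset.sum_le_sum fun i _ => ?_
  have hb := mul_le_setIntegral_ball (f := fun z : ℂ => ((1 + ‖z‖) ^ 3)⁻¹) (r := 1)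
    (m := ((1 + ‖c i‖) ^ 3)⁻¹ / 8) (by
      refine Continuous.inv₀ (by fun_prop) fun z => ?_
      positivity) (c i) (by norm_num) (fun z hz => by
      rw [← one_div, div_div, one_div]
      refine inv_anti₀ (by positivity) ?_
      have : ‖z‖ ≤ ‖c i‖ + 1 := by
        have := norm_le_norm_add_norm_sub' z (c i)
        rw [mem_ball_iff_norm] at hz
        linarith
      calc (1 + ‖z‖) ^ 3 ≤ (2 * (1 + ‖c i‖)) ^ 3 := by
            gcongr
            linarith [norm_nonneg (c i)]
        _ = _ := by ring)
  have hp : 1 ≤ Real.pi := by linarith [Real.pi_gt_three]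
  have : (0 : ℝ) ≤ ((1 + ‖c i‖) ^ 3)⁻¹ := by positivity
  nlinarith

/-- The complement of the closed unit disks with centers `c`. -/
def diskComplement {ι : Type} (c : ι → ℂ) : Set ℂ := {z | ∀ i, 1 < dist z (c i)}

lemma finite_norm_le {ι : Type} {c : ι → ℂ}
    (hsep : ∀ i j, i ≠ j → 100 ≤ dist (c i) (c j)) (R : ℝ) : {i | ‖c i‖ ≤ R}.Finite := by
  by_cases hR : R < 0
  · convert Set.finite_empty
    ext i
    simp only [mem_ofPred_eq, mem_empty_iff_false, iff_false, not_le]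
    exact hR.trans_le (norm_nonneg _)
  have h := (summable_decay hsep).tendsto_cofinite_zero
  have h2 := h.eventually (gt_mem_nhds (show (0 : ℝ) < ((1 + R) ^ 3)⁻¹ by
    push Not at hR; positivity))
  refine Set.Finite.subset h2 fun i hi => ?_
  simp only [mem_ofPred_eq, mem_compl_iff, not_lt] at hi ⊢
  exact inv_anti₀ (by positivity) (by gcongr)

open InnerProductSpace in
/-- Pointwise bound for the source term created by the cutoff, away from the disks in `J`. -/
lemma weighted_sq_planeLap_le {ι : Type} {c : ι → ℂ} {u w : ℂ → ℝ} {B C k L R : ℝ}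
    {J : Finset ι} (hu : HarmonicOnNhd u (diskComplement c))
    (hH : ∀ i, (∀ z w : ℂ, ‖z - c i‖ ∈ Icc 2 4 → ‖w - c i‖ ∈ Icc 2 4 → |u z| ≤ C * |u w|) ∧
      (∀ z : ℂ, ‖z - c i‖ ∈ Icc 2 4 → ‖fderiv ℝ u z‖ ≤ 2 * |u z|))
    (hdec : ∀ z ∈ diskComplement c, |u z| ≤ Real.exp (-(L * ‖z‖)))
    (hk : 1 ≤ k) (hL : 2 * k + 4 ≤ L) (hR : 1 ≤ R) (hJ : ∀ i, ‖c i‖ ≤ 3 * R + 5 → i ∈ J)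
    (hw : ContDiff ℝ 2 w) (hB0 : 0 ≤ B) (hB : DerivBounds B w)
    (hw0 : ∀ i ∈ J, ∀ z, dist z (c i) < 2 → w =ᶠ[𝓝 z] 0)
    (hw1 : ∀ z, 3 * R < ‖z‖ → w =ᶠ[𝓝 z] 0)
    (hw2 : ∀ z, ‖z‖ < 2 * R → (∀ i ∈ J, 3 < dist z (c i)) → w =ᶠ[𝓝 z] 1) (z : ℂ) :
    Real.exp (2 * k * z.re) * planeLap (fun y => u y * w y) z ^ 2 ≤
      ∑ i ∈ J, (ball (c i) 4).indicator (fun _ => (9 * B * C) ^ 2 * Real.exp (6 * k) *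
        (u (c i + 7 / 2) ^ 2 * Real.exp (2 * k * (c i).re))) z +
      (17 * B) ^ 2 * Real.exp (2 * L) / R * ((1 + ‖z‖) ^ 3)⁻¹ := by
  have hterm : ∀ i, 0 ≤ (ball (c i) 4).indicator (fun _ => (9 * B * C) ^ 2 * Real.exp (6 * k) *
        (u (c i + 7 / 2) ^ 2 * Real.exp (2 * k * (c i).re))) z := fun i =>
    indicator_nonneg (fun _ _ => by positivity) z
  have hsum := Finset.sum_nonneg fun i (_ : i ∈ J) => hterm i
  have hrem : 0 ≤ (17 * B) ^ 2 * Real.exp (2 * L) / R * ((1 + ‖z‖) ^ 3)⁻¹ := by positivity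
  have hzero : planeLap (fun y => u y * w y) z = 0 →
      Real.exp (2 * k * z.re) * planeLap (fun y => u y * w y) z ^ 2 ≤
      ∑ i ∈ J, (ball (c i) 4).indicator (fun _ => (9 * B * C) ^ 2 * Real.exp (6 * k) *
        (u (c i + 7 / 2) ^ 2 * Real.exp (2 * k * (c i).re))) z +
      (17 * B) ^ 2 * Real.exp (2 * L) / R * ((1 + ‖z‖) ^ 3)⁻¹ := fun h => by
    rw [h]; simp only [ne_eq, OfNat.ofNat_ne_zero, not_false_eq_true, zero_pow, mul_zero]
    exact add_nonneg hsum hrem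
  have hw_zero : w =ᶠ[𝓝 z] 0 → planeLap (fun y => u y * w y) z = 0 := fun h => by
    have h1 : (fun y => u y * w y) =ᶠ[𝓝 z] fun _ => 0 := by
      filter_upwards [h] with y hy; simp [hy]
    rw [h1.planeLap.eq_of_nhds]
    exact planeLap_eq_zero_of_harmonicAt (harmonicAt_const 0)
  by_cases h3 : 3 * R < ‖z‖
  · exact hzero (hw_zero (hw1 z h3))
  push Not at h3
  by_cases hd : ∃ i ∈ J, dist z (c i) < 2
  · obtain ⟨i, hi, hz⟩ := hd
    exact hzero (hw_zero (hw0 i hi z hz))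
  push Not at hd
  have hfar : ∀ i, 2 ≤ dist z (c i) := fun i => by
    by_cases hi : i ∈ J
    · exact hd i hi
    · have h1 : 3 * R + 5 < ‖c i‖ := by by_contra! h; exact hi (hJ i h)
      have h2 := norm_sub_norm_le (c i) z
      rw [dist_comm, dist_eq_norm]
      linarith
  have hball : ball z 1 ⊆ diskComplement c := fun y hy i => by
    have := dist_triangle z y (c i)
    rw [mem_ball, dist_comm] at hy
    linarith [hfar i]
  have hzu : HarmonicAt u z := hu z (hball (mem_ball_self one_pos))
  have hlap := abs_planeLap_mul_cutoff_le hzu hw hB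
  by_cases hRz : R ≤ ‖z‖
  · set M := Real.exp (-(L * (‖z‖ - 1))) with hM
    have hM0 : 0 < M := Real.exp_pos _
    have hbd : ∀ y ∈ ball z 1, |u y| ≤ M := fun y hy => by
      refine (hdec y (hball hy)).trans (Real.exp_le_exp.2 ?_)
      have := norm_sub_norm_le z y
      rw [mem_ball_iff_norm, norm_sub_rev] at hy
      have h1 : ‖z‖ - 1 ≤ ‖y‖ := by linarith
      nlinarith
    have hfd := norm_fderiv_le_of_bounded_harmonic one_pos (hu.mono hball) hbd
    have huz := hbd z (mem_ball_self one_pos)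
    have hρ : |planeLap (fun y => u y * w y) z| ≤ 17 * B * M := by
      refine hlap.trans ?_
      calc B * (4 * ‖fderiv ℝ u z‖ + |u z|) ≤ B * (4 * (4 * M / 1) + M) := by gcongr
        _ = _ := by ring
    have hsq : planeLap (fun y => u y * w y) z ^ 2 ≤ (17 * B * M) ^ 2 := by
      rw [← sq_abs]; gcongr
    have hM2 : M ^ 2 = Real.exp (2 * L) * Real.exp (-(2 * L * ‖z‖)) := by
      rw [hM, ← Real.exp_nat_mul, ← Real.exp_add]; congr 1; push_cast; ring
    have hre : z.re ≤ ‖z‖ := Complex.re_le_norm z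
    have hexp : Real.exp (2 * k * z.re) * Real.exp (-(2 * L * ‖z‖)) ≤ ((1 + ‖z‖) ^ 3)⁻¹ / R := by
      have h1 : Real.exp (2 * k * z.re) * Real.exp (-(2 * L * ‖z‖)) ≤ (Real.exp ‖z‖ ^ 4)⁻¹ := by
        rw [← Real.exp_nat_mul, ← Real.exp_neg, ← Real.exp_add]
        apply Real.exp_le_exp.2
        push_cast
        nlinarith [norm_nonneg z]
      refine h1.trans ?_
      have h2 : 1 + ‖z‖ ≤ Real.exp ‖z‖ := by linarith [Real.add_one_le_exp ‖z‖]
      rw [← one_div ((1 + ‖z‖) ^ 3), div_div, one_div]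
      refine inv_anti₀ (by positivity) ?_
      calc (1 + ‖z‖) ^ 3 * R ≤ (1 + ‖z‖) ^ 3 * (1 + ‖z‖) := by gcongr; linarith
        _ = (1 + ‖z‖) ^ 4 := by ring
        _ ≤ _ := by gcongr
    refine le_trans ?_ (le_add_of_nonneg_left hsum)
    calc Real.exp (2 * k * z.re) * planeLap (fun y => u y * w y) z ^ 2
        ≤ Real.exp (2 * k * z.re) * (17 * B * M) ^ 2 := by gcongr
      _ = (17 * B) ^ 2 * Real.exp (2 * L) *
          (Real.exp (2 * k * z.re) * Real.exp (-(2 * L * ‖z‖))) := by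
        rw [mul_pow, hM2]; ring
      _ ≤ (17 * B) ^ 2 * Real.exp (2 * L) * (((1 + ‖z‖) ^ 3)⁻¹ / R) := by gcongr
      _ = _ := by ring
  push Not at hRz
  by_cases hn : ∃ i ∈ J, dist z (c i) ≤ 3
  · obtain ⟨i, hi, hz⟩ := hn
    have hmem : ‖z - c i‖ ∈ Icc (2 : ℝ) 4 := by
      rw [← dist_eq_norm]; exact ⟨hfar i, by linarith⟩
    have hmem' : ‖c i + 7 / 2 - c i‖ ∈ Icc (2 : ℝ) 4 := by
      rw [add_sub_cancel_left]; norm_num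
    have h1 := (hH i).1 z (c i + 7 / 2) hmem hmem'
    have h2 := (hH i).2 z hmem
    have hρ : |planeLap (fun y => u y * w y) z| ≤ 9 * B * C * |u (c i + 7 / 2)| := by
      refine hlap.trans ?_
      calc B * (4 * ‖fderiv ℝ u z‖ + |u z|) ≤ B * (4 * (2 * |u z|) + |u z|) := by gcongr
        _ = 9 * B * |u z| := by ring
        _ ≤ 9 * B * (C * |u (c i + 7 / 2)|) := by gcongr
        _ = _ := by ring
    have hsq : planeLap (fun y => u y * w y) z ^ 2 ≤ (9 * B * C) ^ 2 * u (c i + 7 / 2) ^ 2 := by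
      rw [← sq_abs, ← sq_abs (u _), ← mul_pow]; gcongr
    have hre : z.re ≤ (c i).re + 3 := by
      have := Complex.re_le_norm (z - c i)
      rw [← dist_eq_norm, Complex.sub_re] at this
      linarith
    have hexp : Real.exp (2 * k * z.re) ≤ Real.exp (6 * k) * Real.exp (2 * k * (c i).re) := by
      rw [← Real.exp_add]
      apply Real.exp_le_exp.2
      nlinarith
    have hs := Finset.single_le_sum (fun i (_ : i ∈ J) => hterm i) hi
    rw [indicator_of_mem (mem_ball.2 (by linarith))] at hs
    refine le_trans ?_ (le_add_of_nonneg_right hrem)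
    refine le_trans ?_ hs
    calc Real.exp (2 * k * z.re) * planeLap (fun y => u y * w y) z ^ 2
        ≤ (Real.exp (6 * k) * Real.exp (2 * k * (c i).re)) *
          ((9 * B * C) ^ 2 * u (c i + 7 / 2) ^ 2) := by gcongr
      _ = _ := by ring
  · push Not at hn
    refine hzero ?_
    have h1 : (fun y => u y * w y) =ᶠ[𝓝 z] u := by
      filter_upwards [hw2 z (by linarith) hn] with y hy; simp [hy]
    rw [h1.planeLap.eq_of_nhds]
    exact planeLap_eq_zero_of_harmonicAt hzu

lemma contDiff_mul_cutoff {ι : Type} {c : ι → ℂ} {u w : ℂ → ℝ} {R : ℝ} {J : Finset ι}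
    (hu : InnerProductSpace.HarmonicOnNhd u (diskComplement c))
    (hJ : ∀ i, ‖c i‖ ≤ 3 * R + 5 → i ∈ J) (hw : ContDiff ℝ 2 w)
    (hw0 : ∀ i ∈ J, ∀ z, dist z (c i) < 2 → w =ᶠ[𝓝 z] 0)
    (hw1 : ∀ z, 3 * R < ‖z‖ → w =ᶠ[𝓝 z] 0) : ContDiff ℝ 2 fun y => u y * w y := by
  refine contDiff_iff_contDiffAt.2 fun z => ?_
  by_cases hz : z ∈ diskComplement c
  · exact (hu z hz).1.mul hw.contDiffAt
  have hw' : w =ᶠ[𝓝 z] 0 := by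
    simp only [diskComplement, mem_ofPred_eq, not_forall, not_lt] at hz
    obtain ⟨i, hi⟩ := hz
    by_cases h : 3 * R < ‖z‖
    · exact hw1 z h
    · refine hw0 i (hJ i ?_) z (by linarith)
      have := norm_sub_norm_le (c i) z
      rw [dist_comm, dist_eq_norm] at hi
      linarith
  have h1 : (fun y => u y * w y) =ᶠ[𝓝 z] fun _ => 0 := by
    filter_upwards [hw'] with y hy; simp [hy]
  exact contDiffAt_const.congr_of_eventuallyEq h1

open InnerProductSpace in
/-- The Carleman estimate bounds the mass near the disks by a multiple of itself, which is
smaller by an exponential factor in `k`, up to an error vanishing as `R → ∞`. -/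
lemma energy_le {ι : Type} {c : ι → ℂ} (hsep : ∀ i j, i ≠ j → 100 ≤ dist (c i) (c j))
    {u w : ℂ → ℝ} {B C k L R : ℝ} {J J' : Finset ι}
    (hu : HarmonicOnNhd u (diskComplement c))
    (hH : ∀ i, (∀ z w : ℂ, ‖z - c i‖ ∈ Icc 2 4 → ‖w - c i‖ ∈ Icc 2 4 → |u z| ≤ C * |u w|) ∧
      (∀ z : ℂ, ‖z - c i‖ ∈ Icc 2 4 → ‖fderiv ℝ u z‖ ≤ 2 * |u z|))
    (hdec : ∀ z ∈ diskComplement c, |u z| ≤ Real.exp (-(L * ‖z‖)))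
    (hk : 1 ≤ k) (hL : 2 * k + 4 ≤ L) (hR : 1 ≤ R)
    (hJ : ∀ i, ‖c i‖ ≤ 3 * R + 5 → i ∈ J)
    (hJ' : ∀ i ∈ J', i ∈ J ∧ ‖c i‖ + 4 ≤ 2 * R)
    (hw : ContDiff ℝ 2 w) (hws : HasCompactSupport w) (hB0 : 0 ≤ B) (hB : DerivBounds B w)
    (hw0 : ∀ i ∈ J, ∀ z, dist z (c i) < 2 → w =ᶠ[𝓝 z] 0)
    (hw1 : ∀ z, 3 * R < ‖z‖ → w =ᶠ[𝓝 z] 0)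
    (hw2 : ∀ z, ‖z‖ < 2 * R → (∀ i ∈ J, 3 < dist z (c i)) → w =ᶠ[𝓝 z] 1) :
    Real.pi / 16 * Real.exp (13 / 2 * k) *
      ∑ i ∈ J', u (c i + 7 / 2) ^ 2 * Real.exp (2 * k * (c i).re) ≤
    C ^ 2 * (49 / 4) * (16 * Real.pi * (9 * B * C) ^ 2 * Real.exp (6 * k) *
      ∑ i ∈ J, u (c i + 7 / 2) ^ 2 * Real.exp (2 * k * (c i).re) +
      (17 * B) ^ 2 * Real.exp (2 * L) / R * ∫ z : ℂ, ((1 + ‖z‖) ^ 3)⁻¹) := by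
  set h : ℂ → ℝ := fun y => u y * w y with hh
  have hhc : ContDiff ℝ 2 h := contDiff_mul_cutoff hu hJ hw hw0 hw1
  have hhs : HasCompactSupport h := hws.mul_left
  set g : ℂ → ℝ := fun y => Real.exp (k * y.re) * h y with hg
  have hgc : ContDiff ℝ (2 : ℕ) g := by
    have : ContDiff ℝ 2 g := (contDiff_exp_mul_re k).mul hhc
    exact_mod_cast this
  have hgs : HasCompactSupport g := hhs.mul_left
  have hgd : Continuous fun z => dirDeriv 1 g z ^ 2 :=
    ((hgc.dirDeriv (n := 1) (by norm_num) 1).continuous).pow 2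
  have hgi : Integrable fun z => dirDeriv 1 g z ^ 2 := by
    refine hgd.integrable_of_hasCompactSupport ?_
    have e : (fun z => dirDeriv 1 g z ^ 2) = dirDeriv 1 g * dirDeriv 1 g := by
      ext z; simp [sq]
    rw [e]
    exact (hgs.dirDeriv 1).mul_left
  have hupper : ∫ z, Real.exp (2 * k * z.re) * planeLap h z ^ 2 ≤
      16 * Real.pi * (9 * B * C) ^ 2 * Real.exp (6 * k) *
      ∑ i ∈ J, u (c i + 7 / 2) ^ 2 * Real.exp (2 * k * (c i).re) +
      (17 * B) ^ 2 * Real.exp (2 * L) / R * ∫ z : ℂ, ((1 + ‖z‖) ^ 3)⁻¹ := by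
    have hI1 : ∀ i, Integrable ((ball (c i) 4).indicator (fun _ => (9 * B * C) ^ 2 *
        Real.exp (6 * k) * (u (c i + 7 / 2) ^ 2 * Real.exp (2 * k * (c i).re)))) := fun i =>
      (integrable_indicator_iff measurableSet_ball).2 (integrableOn_const measure_ball_lt_top.ne)
    have hI2 := integrable_finsetSum J fun i _ => hI1 i
    have hI3 := integrable_decay.const_mul ((17 * B) ^ 2 * Real.exp (2 * L) / R)
    refine (integral_mono_of_nonneg (Eventually.of_forall fun z => by positivity)
      (hI2.add hI3) (Eventually.of_forall fun z => ?_)).trans_eq ?_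
    · exact weighted_sq_planeLap_le hu hH hdec hk hL hR hJ hw hB0 hB hw0 hw1 hw2 z
    · rw [integral_add' hI2 hI3, integral_const_mul, integral_finsetSum J fun i _ => hI1 i,
        Finset.mul_sum]
      congr 1
      refine Finset.sum_congr rfl fun i _ => ?_
      rw [integral_indicator measurableSet_ball, setIntegral_const,
        volume_real_ball _ (by norm_num), smul_eq_mul]
      ring
  have hcar : ∫ z, dirDeriv 1 g z ^ 2 ≤ ∫ z, Real.exp (2 * k * z.re) * planeLap h z ^ 2 := by
    refine le_trans ?_ (carleman hhc hhs k)
    have h0 : 0 ≤ ∫ z, dirDeriv 1 g z ^ 2 := integral_nonneg fun z => by positivity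
    refine le_mul_of_one_le_left h0 ?_
    nlinarith
  have hlow : ∀ i ∈ J', Real.pi / 16 * Real.exp (13 / 2 * k) *
      (u (c i + 7 / 2) ^ 2 * Real.exp (2 * k * (c i).re)) ≤
      C ^ 2 * (49 / 4) * ∫ z in ball (c i) (1 / 4 + 7 / 2), dirDeriv 1 g z ^ 2 := by
    intro i hi
    obtain ⟨hiJ, hiR⟩ := hJ' i hi
    have hg0 : ∀ z ∈ ball (c i) (1 / 4), g z = 0 := fun z hz => by
      have := (hw0 i hiJ z (by linarith [mem_ball.1 hz])).eq_of_nhds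
      simp [hg, hh, this]
    have ht := setIntegral_sq_translate_le (hgc.of_le (by norm_num)) (r := 1 / 4) (s := 7 / 2)
      (by norm_num) hg0
    have hpt : ∀ z ∈ ball (c i) (1 / 4), Real.exp (13 / 2 * k) *
        (u (c i + 7 / 2) ^ 2 * Real.exp (2 * k * (c i).re)) ≤
        C ^ 2 * g (z + ((7 / 2 : ℝ) : ℂ)) ^ 2 := by
      intro z hz
      set y := z + ((7 / 2 : ℝ) : ℂ) with hy
      have hs : ‖((7 / 2 : ℝ) : ℂ)‖ = 7 / 2 := by
        rw [Complex.norm_real]; norm_num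
      rw [mem_ball_iff_norm] at hz
      have hy1 : ‖y - c i‖ ≤ 15 / 4 := by
        have := norm_add_le (z - c i) ((7 / 2 : ℝ) : ℂ)
        rw [show y - c i = z - c i + ((7 / 2 : ℝ) : ℂ) by rw [hy]; ring]
        linarith
      have hy2 : 13 / 4 ≤ ‖y - c i‖ := by
        have := norm_sub_norm_le ((7 / 2 : ℝ) : ℂ) (-(z - c i))
        rw [norm_neg] at this
        rw [show y - c i = ((7 / 2 : ℝ) : ℂ) - -(z - c i) by rw [hy]; ring]
        linarith
      have hwy : w y = 1 := by
        refine (hw2 y ?_ fun j hj => ?_).eq_of_nhds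
        · have := norm_le_norm_add_norm_sub' y (c i)
          linarith
        · by_cases hji : j = i
          · rw [hji, dist_eq_norm]; linarith
          · have h1 := hsep j i hji
            have h2 := dist_triangle (c j) y (c i)
            rw [dist_eq_norm y (c i), dist_comm (c j) y] at h2
            linarith
      have hmem' : ‖c i + 7 / 2 - c i‖ ∈ Icc (2 : ℝ) 4 := by
        rw [add_sub_cancel_left]; norm_num
      have hle := (hH i).1 (c i + 7 / 2) y hmem' ⟨by linarith, by linarith⟩
      have hsq : u (c i + 7 / 2) ^ 2 ≤ C ^ 2 * u y ^ 2 := by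
        rw [← sq_abs, ← sq_abs (u y), ← mul_pow]; gcongr
      have hre : (c i).re + 13 / 4 ≤ y.re := by
        have := Complex.abs_re_le_norm (z - c i)
        rw [Complex.sub_re] at this
        have h1 := (abs_le.1 this).1
        have h2 : y.re = z.re + 7 / 2 := by rw [hy, Complex.add_re, Complex.ofReal_re]
        linarith
      have hexp : Real.exp (13 / 2 * k) * Real.exp (2 * k * (c i).re) ≤
          Real.exp (k * y.re) ^ 2 := by
        rw [← Real.exp_add, ← Real.exp_nat_mul]
        apply Real.exp_le_exp.2
        push_cast
        nlinarith
      calc Real.exp (13 / 2 * k) * (u (c i + 7 / 2) ^ 2 * Real.exp (2 * k * (c i).re))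
          = (Real.exp (13 / 2 * k) * Real.exp (2 * k * (c i).re)) * u (c i + 7 / 2) ^ 2 := by ring
        _ ≤ Real.exp (k * y.re) ^ 2 * (C ^ 2 * u y ^ 2) := by gcongr
        _ = C ^ 2 * g y ^ 2 := by simp only [hg, hh, hwy]; ring
    have hb := mul_le_setIntegral_ball (f := fun z => C ^ 2 * g (z + ((7 / 2 : ℝ) : ℂ)) ^ 2)
      (by have := hgc.continuous; fun_prop) (c i) (by norm_num) hpt
    rw [integral_const_mul] at hb
    have := mul_le_mul_of_nonneg_left ht (sq_nonneg C)
    linarith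
  calc Real.pi / 16 * Real.exp (13 / 2 * k) *
      ∑ i ∈ J', u (c i + 7 / 2) ^ 2 * Real.exp (2 * k * (c i).re)
      ≤ ∑ i ∈ J', C ^ 2 * (49 / 4) *
        ∫ z in ball (c i) (1 / 4 + 7 / 2), dirDeriv 1 g z ^ 2 := by
        rw [Finset.mul_sum]; exact Finset.sum_le_sum hlow
    _ ≤ C ^ 2 * (49 / 4) * ∫ z, dirDeriv 1 g z ^ 2 := by
        rw [← Finset.mul_sum]
        gcongr
        exact sum_setIntegral_ball_le hsep (by norm_num) hgi (fun z => by positivity) J'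
    _ ≤ _ := by
        gcongr
        exact hcar.trans hupper

lemma annulus_subset_diskComplement {ι : Type} {c : ι → ℂ}
    (hsep : ∀ i j, i ≠ j → 100 ≤ dist (c i) (c j)) (i : ι) :
    ball (c i) 5 \ closedBall (c i) 1 ⊆ diskComplement c := by
  intro z hz j
  rw [Set.mem_sdiff, mem_ball, mem_closedBall, not_le] at hz
  by_cases hji : j = i
  · rw [hji]; exact hz.2
  · have h1 := hsep j i hji
    have h2 := dist_triangle (c j) z (c i)
    rw [dist_comm (c j) z] at h2
    linarith [hz.1]

open InnerProductSpace in
/-- Sufficiently fast decay forces `u` to vanish at a point near each disk. -/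
lemma exists_decay_forces_zero : ∃ k : ℝ, 1 ≤ k ∧ ∀ (ι : Type) (c : ι → ℂ) (u : ℂ → ℝ) (L : ℝ),
    (∀ i j, i ≠ j → 100 ≤ dist (c i) (c j)) → HarmonicOnNhd u (diskComplement c) →
    (∀ i, (∀ z ∈ ball (c i) 5 \ closedBall (c i) 1, 0 ≤ u z) ∨
      (∀ z ∈ ball (c i) 5 \ closedBall (c i) 1, u z ≤ 0)) →
    (∀ z ∈ diskComplement c, |u z| ≤ Real.exp (-(L * ‖z‖))) → 2 * k + 4 ≤ L →
    ∀ i, u (c i + 7 / 2) = 0 := by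
  obtain ⟨C, hC1, hann⟩ := exists_annulus_bounds
  obtain ⟨B, hB0, hcut⟩ := exists_cutoff
  set D : ℝ := C ^ 2 * (49 / 4) * (256 * (9 * B * C) ^ 2) with hD
  have hD0 : 0 ≤ D := by positivity
  refine ⟨2 * D + 1, by linarith, fun ι c u L hsep hu hs hdec hL => ?_⟩
  set k : ℝ := 2 * D + 1 with hk
  have hk1 : 1 ≤ k := by linarith
  have hL0 : 0 ≤ L := by linarith
  have hH := fun i => hann u (c i) (hu.mono (annulus_subset_diskComplement hsep i)) (hs i)
  set a : ι → ℝ := fun i => u (c i + 7 / 2) ^ 2 * Real.exp (2 * k * (c i).re) with ha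
  have ha0 : ∀ i, 0 ≤ a i := fun i => by positivity
  have hpt : ∀ i, c i + 7 / 2 ∈ diskComplement c := fun i =>
    annulus_subset_diskComplement hsep i <| by
      rw [Set.mem_sdiff, mem_ball_iff_norm, mem_closedBall_iff_norm, add_sub_cancel_left]
      norm_num
  have hle : ∀ i, a i ≤ Real.exp (7 * L) * ((1 + ‖c i‖) ^ 3)⁻¹ := by
    intro i
    have h1 : ‖c i‖ - 7 / 2 ≤ ‖c i + 7 / 2‖ := by
      have := norm_sub_le (c i + 7 / 2) (7 / 2)
      rw [add_sub_cancel_right] at this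
      norm_num at this
      linarith
    have h2 : |u (c i + 7 / 2)| ≤ Real.exp (-(L * (‖c i‖ - 7 / 2))) :=
      (hdec _ (hpt i)).trans (Real.exp_le_exp.2 (by nlinarith))
    have h3 : (Real.exp (‖c i‖) ^ 3)⁻¹ ≤ ((1 + ‖c i‖) ^ 3)⁻¹ := by
      refine inv_anti₀ (by positivity) ?_
      gcongr
      linarith [Real.add_one_le_exp ‖c i‖]
    have hre : (c i).re ≤ ‖c i‖ := Complex.re_le_norm _
    calc a i ≤ Real.exp (-(L * (‖c i‖ - 7 / 2))) ^ 2 * Real.exp (2 * k * (c i).re) := by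
          simp only [ha]
          rw [← sq_abs]
          gcongr
      _ ≤ Real.exp (7 * L) * (Real.exp (‖c i‖) ^ 3)⁻¹ := by
          rw [← Real.exp_nat_mul, ← Real.exp_nat_mul, ← Real.exp_neg, ← Real.exp_add,
            ← Real.exp_add]
          apply Real.exp_le_exp.2
          push_cast
          nlinarith [norm_nonneg (c i)]
      _ ≤ _ := by gcongr
  have hsum : Summable a :=
    Summable.of_nonneg_of_le ha0 hle ((summable_decay hsep).mul_left _)
  set P : ℝ := Real.pi / 16 * Real.exp (13 / 2 * k) with hP
  set Q : ℝ := C ^ 2 * (49 / 4) * (16 * Real.pi * (9 * B * C) ^ 2 * Real.exp (6 * k)) with hQ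
  set W : ℝ := C ^ 2 * (49 / 4) * ((17 * B) ^ 2 * Real.exp (2 * L) * ∫ z : ℂ, ((1 + ‖z‖) ^ 3)⁻¹)
    with hW
  have hmain : ∀ J' : Finset ι, P * ∑ i ∈ J', a i ≤ Q * ∑' i, a i := by
    intro J'
    have hlim : Tendsto (fun R : ℝ => Q * ∑' i, a i + W * R⁻¹) atTop (𝓝 (Q * ∑' i, a i)) := by
      simpa using (tendsto_inv_atTop_zero.const_mul W).const_add (Q * ∑' i, a i)
    refine ge_of_tendsto hlim ?_
    have hev : ∀ᶠ R : ℝ in atTop, ∀ i ∈ J', ‖c i‖ + 4 ≤ R := by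
      rw [Filter.eventually_all_finset]
      exact fun i _ => eventually_ge_atTop _
    filter_upwards [hev, eventually_ge_atTop 1] with R hR hR1
    set J := (finite_norm_le hsep (3 * R + 5)).toFinset with hJ
    have hmemJ : ∀ i, i ∈ J ↔ ‖c i‖ ≤ 3 * R + 5 := fun i => by simp [hJ]
    obtain ⟨w, hw, hws, hB, hw0, hw1, hw2⟩ := hcut ι c hsep J R hR1
    have hen := energy_le hsep (J' := J') hu hH hdec hk1 hL hR1
      (fun i hi => (hmemJ i).2 hi)
      (fun i hi => ⟨(hmemJ i).2 (by linarith [hR i hi]), by linarith [hR i hi]⟩)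
      hw hws hB0.le hB hw0 hw1 hw2
    refine hen.trans ?_
    have hJs : ∑ i ∈ J, a i ≤ ∑' i, a i := hsum.sum_le_tsum J fun i _ => ha0 i
    have hQ0 : 0 ≤ Q := by positivity
    have := mul_le_mul_of_nonneg_left hJs hQ0
    calc _ = Q * ∑ i ∈ J, a i + W * R⁻¹ := by rw [hQ, hW]; ring
      _ ≤ _ := by linarith
  have hPQ : Q < P := by
    have h1 : D < Real.exp (k / 2) := by linarith [Real.add_one_le_exp (k / 2)]
    have h2 : P = Real.pi / 16 * Real.exp (6 * k) * Real.exp (k / 2) := by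
      rw [hP, mul_assoc, ← Real.exp_add]; congr 2; ring
    have h3 : Q = Real.pi / 16 * Real.exp (6 * k) * D := by rw [hQ, hD]; ring
    rw [h2, h3]
    gcongr
  have hP0 : 0 < P := by positivity
  have hS : P * ∑' i, a i ≤ Q * ∑' i, a i := by
    rw [← tsum_mul_left]
    refine (hsum.mul_left P).tsum_le_of_sum_le fun J' => ?_
    rw [← Finset.mul_sum]
    exact hmain J'
  intro i
  have hi : a i ≤ ∑' i, a i := hsum.le_tsum i fun j _ => ha0 j
  have : a i = 0 := by nlinarith [ha0 i]
  simpa [ha, (Real.exp_pos _).ne'] using this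

open InnerProductSpace in
/-- A harmonic function without sign change on an annulus vanishes there once it has a zero. -/
lemma eq_zero_on_annulus {u : ℂ → ℝ} {c p : ℂ} (hu : HarmonicOnNhd u (ball c 5 \ closedBall c 1))
    (hs : (∀ z ∈ ball c 5 \ closedBall c 1, 0 ≤ u z) ∨ (∀ z ∈ ball c 5 \ closedBall c 1, u z ≤ 0))
    (hp : p ∈ ball c 5 \ closedBall c 1) (hup : u p = 0) :
    ∀ z ∈ ball c 5 \ closedBall c 1, u z = 0 := by
  have main : ∀ v : ℂ → ℝ, HarmonicOnNhd v (ball c 5 \ closedBall c 1) →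
      (∀ z ∈ ball c 5 \ closedBall c 1, 0 ≤ v z) → v p = 0 →
      ∀ z ∈ ball c 5 \ closedBall c 1, v z = 0 := by
    intro v hv h0 hvp z hz
    have hz' := hz
    rw [Set.mem_sdiff, mem_ball_iff_norm, mem_closedBall_iff_norm, not_le] at hz' hp
    set ε := min (min (‖z - c‖ - 1) (5 - ‖z - c‖)) (min (‖p - c‖ - 1) (5 - ‖p - c‖)) with hε
    have e1 : ε ≤ ‖z - c‖ - 1 := (min_le_left _ _).trans (min_le_left _ _)
    have e2 : ε ≤ 5 - ‖z - c‖ := (min_le_left _ _).trans (min_le_right _ _)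
    have e3 : ε ≤ ‖p - c‖ - 1 := (min_le_right _ _).trans (min_le_left _ _)
    have e4 : ε ≤ 5 - ‖p - c‖ := (min_le_right _ _).trans (min_le_right _ _)
    have e0 : 0 < ε := by
      simp only [hε, lt_min_iff, sub_pos]
      exact ⟨⟨hz'.2, hz'.1⟩, hp.2, hp.1⟩
    obtain ⟨C, -, h⟩ := exists_harnack_annulus e0 (by linarith)
    have := h v c hv h0 z p ⟨by linarith, by linarith⟩ ⟨by linarith, by linarith⟩
    rw [hvp, mul_zero] at this
    exact le_antisymm this (h0 z hz)
  rcases hs with hs | hs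
  · exact main u hu hs hup
  · intro z hz
    have := main (-u) hu.neg (fun z hz => by simpa using hs z hz) (by simpa using hup) z hz
    simpa using this

open InnerProductSpace in
/-- A decaying harmonic function outside separated disks that vanishes around each disk is zero. -/
lemma eq_zero_of_eq_zero_on_annuli {ι : Type} {c : ι → ℂ} {u : ℂ → ℝ} {L : ℝ}
    (hu : HarmonicOnNhd u (diskComplement c))
    (h0 : ∀ i, ∀ z ∈ ball (c i) 5 \ closedBall (c i) 1, u z = 0)
    (hL : 0 < L) (hdec : ∀ z ∈ diskComplement c, |u z| ≤ Real.exp (-(L * ‖z‖))) :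
    ∀ z ∈ diskComplement c, u z = 0 := by
  classical
  set v : ℂ → ℝ := fun z => if z ∈ diskComplement c then u z else 0 with hv
  have hvball : ∀ i, ∀ z ∈ ball (c i) 5, v z = 0 := by
    intro i z hz
    by_cases hzΩ : z ∈ diskComplement c
    · simp only [hv, if_pos hzΩ]
      refine h0 i z ⟨hz, ?_⟩
      rw [mem_closedBall, not_le]
      exact hzΩ i
    · simp only [hv, if_neg hzΩ]
  have hvb : ∀ z, |v z| ≤ Real.exp (-(L * ‖z‖)) := by
    intro z
    by_cases hz : z ∈ diskComplement c
    · simpa only [hv, if_pos hz] using hdec z hz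
    · simp only [hv, if_neg hz, abs_zero]; positivity
  have hvh : HarmonicOnNhd v univ := by
    intro z _
    by_cases hz : ∃ i, dist z (c i) < 5
    · obtain ⟨i, hi⟩ := hz
      refine (harmonicAt_congr_nhds ?_).2 (harmonicAt_const (0 : ℝ))
      filter_upwards [isOpen_ball.mem_nhds (mem_ball.2 hi)] with y hy
      exact hvball i y hy
    · push Not at hz
      have hb : ball z 1 ⊆ diskComplement c := fun y hy i => by
        have := dist_triangle z y (c i)
        rw [mem_ball, dist_comm] at hy
        linarith [hz i]
      refine (harmonicAt_congr_nhds ?_).2 (hu z (hb (mem_ball_self one_pos)))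
      filter_upwards [ball_mem_nhds z one_pos] with y hy
      simp only [hv, if_pos (hb hy)]
  have hlim : Tendsto (fun t : ℝ => Real.exp (-(L * t))) atTop (𝓝 0) :=
    Real.tendsto_exp_neg_atTop_nhds_zero.comp (tendsto_id.const_mul_atTop hL)
  intro z hz
  have hvbdd : Bornology.IsBounded (range v) := by
    refine isBounded_iff_forall_norm_le.2 ⟨1, ?_⟩
    rintro _ ⟨y, rfl⟩
    refine (hvb y).trans (Real.exp_le_one_iff.2 ?_)
    have : 0 ≤ L * ‖y‖ := by positivity
    linarith
  have hconst := bounded_harmonic_on_complex_plane_is_constant v hvh hvbdd z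
  have hle : |v z| ≤ 0 := by
    refine ge_of_tendsto hlim ?_
    filter_upwards [eventually_ge_atTop 0] with t ht
    rw [hconst t]
    refine (hvb _).trans_eq ?_
    rw [Complex.norm_real, Real.norm_of_nonneg ht]
  have := abs_nonpos_iff.1 hle
  simpa only [hv, if_pos hz] using this

lemma isOpen_diskComplement {ι : Type} {c : ι → ℂ}
    (hsep : ∀ i j, i ≠ j → 100 ≤ dist (c i) (c j)) : IsOpen (diskComplement c) := by
  refine isOpen_iff_mem_nhds.2 fun z hz => ?_
  by_cases h : ∃ i, dist z (c i) < 5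
  · obtain ⟨i, hi⟩ := h
    refine mem_of_superset ((isOpen_ball.sdiff isClosed_closedBall).mem_nhds
      ⟨mem_ball.2 hi, ?_⟩) (annulus_subset_diskComplement hsep i)
    rw [mem_closedBall, not_le]
    exact hz i
  · push Not at h
    filter_upwards [ball_mem_nhds z one_pos] with y hy i
    have := dist_triangle z y (c i)
    rw [mem_ball, dist_comm] at hy
    linarith [h i]

open InnerProductSpace in
lemma exists_harmonic_eq_zero : ∃ L₀ : ℝ, 0 < L₀ ∧
    ∀ (ι : Type) (c : ι → ℂ) (u : ℂ → ℝ) (L : ℝ),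
    (∀ i j, i ≠ j → 100 ≤ dist (c i) (c j)) → HarmonicOnNhd u (diskComplement c) →
    (∀ i, (∀ z ∈ ball (c i) 5 \ closedBall (c i) 1, 0 ≤ u z) ∨
      (∀ z ∈ ball (c i) 5 \ closedBall (c i) 1, u z ≤ 0)) → L₀ ≤ L →
    (∀ z ∈ diskComplement c, |u z| ≤ Real.exp (-(L * ‖z‖))) → ∀ z ∈ diskComplement c, u z = 0 := by
  obtain ⟨k, hk, H⟩ := exists_decay_forces_zero
  refine ⟨2 * k + 4, by linarith, fun ι c u L hsep hu hs hL hdec => ?_⟩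
  refine eq_zero_of_eq_zero_on_annuli hu (fun i => ?_) (by linarith) hdec
  refine eq_zero_on_annulus (hu.mono (annulus_subset_diskComplement hsep i)) (hs i) ?_
    (H ι c u L hsep hu hs hdec hL i)
  rw [Set.mem_sdiff, mem_ball_iff_norm, mem_closedBall_iff_norm, add_sub_cancel_left]
  norm_num

lemma planeLap_comp_repr (u : E2 → ℝ) (z : ℂ) :
    planeLap (u ∘ Complex.orthonormalBasisOneI.repr) z =
      lap u (Complex.orthonormalBasisOneI.repr z) := by
  set e := Complex.orthonormalBasisOneI.repr with he
  have h0 : e 1 = EuclideanSpace.single 0 1 := by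
    simpa using Complex.orthonormalBasisOneI.repr_self 0
  have h1 : e Complex.I = EuclideanSpace.single 1 1 := by
    simpa using Complex.orthonormalBasisOneI.repr_self 1
  have hd (f : E2 → ℝ) (v : ℂ) :
      dirDeriv v (f ∘ e) = (fun x => fderiv ℝ f x (e v)) ∘ e := by
    ext z
    simp only [dirDeriv, Function.comp_apply]
    exact congrArg (fun l : ℂ →L[ℝ] ℝ => l v)
      (e.toContinuousLinearEquiv.comp_right_fderiv (f := f) (x := z))
  rw [planeLap, hd, hd, hd, hd, lap, Fin.sum_univ_two, h0, h1]
  rfl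

/-- **Theorem 5 (toy problem).** A harmonic function on the plane punctured by `100`-separated
unit disks, with no sign change in the annuli `5Dⱼ ∖ Dⱼ`, which decays like `e^{-L|z|}` for a
sufficiently large absolute constant `L`, vanishes identically. -/
theorem toy_problem :
    ∃ L₀ : ℝ, 0 < L₀ ∧
      ∀ (ι : Type) (c : ι → E2) (u : E2 → ℝ) (L : ℝ),
        UnitBallsSeparated c 100 →
        HarmonicOnSet u ((Set.univ : Set E2) \ ⋃ i, closedBall (c i) 1) →
        (∀ i, NoSignChange u (closedBall (c i) 5 \ closedBall (c i) 1)) →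
        L₀ ≤ L →
        (∀ z : E2, z ∉ ⋃ i, closedBall (c i) 1 → |u z| ≤ Real.exp (-(L * ‖z‖))) →
        ∀ z : E2, z ∉ ⋃ i, closedBall (c i) 1 → u z = 0 := by
  obtain ⟨L₀, hL₀, H⟩ := exists_harmonic_eq_zero
  refine ⟨L₀, hL₀, fun ι c u L hsep hu hs hL hdec z hz => ?_⟩
  set e := Complex.orthonormalBasisOneI.repr with he
  have hdist (y : ℂ) (i : ι) : dist y (e.symm (c i)) = dist (e y) (c i) := by
    rw [← e.dist_map, e.apply_symm_apply]
  have hmem (y : ℂ) : y ∈ diskComplement (fun i => e.symm (c i)) ↔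
      e y ∉ ⋃ i, closedBall (c i) 1 := by
    simp [diskComplement, hdist]
  have hsep' : ∀ i j, i ≠ j → 100 ≤ dist (e.symm (c i)) (e.symm (c j)) := fun i j hij => by
    rw [e.symm.dist_map]
    exact hsep i j hij _ (mem_closedBall_self zero_le_one) _ (mem_closedBall_self zero_le_one)
  have hC2 : ∀ y ∈ diskComplement (fun i => e.symm (c i)), ContDiffAt ℝ 2 (u ∘ e) y :=
    fun y hy => ((hu (e y) ⟨mem_univ _, (hmem y).1 hy⟩).1).comp y e.contDiff.contDiffAt
  have hharm : InnerProductSpace.HarmonicOnNhd (u ∘ e)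
      (diskComplement (fun i => e.symm (c i))) := by
    refine fun y hy => ⟨hC2 y hy, ?_⟩
    filter_upwards [(isOpen_diskComplement hsep').mem_nhds hy] with x hx
    rw [laplacian_eq_planeLap (hC2 x hx), planeLap_comp_repr]
    exact (hu (e x) ⟨mem_univ _, (hmem x).1 hx⟩).2
  have hann (i : ι) (y : ℂ) (hy : y ∈ ball (e.symm (c i)) 5 \ closedBall (e.symm (c i)) 1) :
      e y ∈ closedBall (c i) 5 \ closedBall (c i) 1 := by
    rw [Set.mem_sdiff, mem_ball, mem_closedBall, hdist] at hy
    exact ⟨mem_closedBall.2 hy.1.le, hy.2⟩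
  have hzero := H ι (fun i => e.symm (c i)) (u ∘ e) L hsep' hharm
    (fun i => (hs i).imp (fun h y hy => h _ (hann i y hy)) fun h y hy => h _ (hann i y hy)) hL
    (fun y hy => by simpa using! hdec (e y) ((hmem y).1 hy)) (e.symm z)
    ((hmem _).2 (by rwa [e.apply_symm_apply]))
  simpa using hzero
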